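/- Fix C ≥ 1. There exist C' = C'(C) > 0 and n_0 = n_0(C) such that the following holds for all n ≥ n_0. Let a_1, a_2, a_3, a_4 ∈ [−C, C], let k be an integer with k = β·n where min(β, 1−β) ≥ 1/C, and let X_1 ∼ Bin(k−1, 1/2 + a_1/(2√n)), X_2 ∼ Bin(n−k, 1/2 + a_2/(2√n)), X_3 ∼ Bin(k, 1/2 + a_3/(2√n)), X_4 ∼ Bin(n−k, 1/2 + a_4/(2√n)) be independent. Then for every integer Γ with |Γ| ≤ √n, writing γ = Γ/√n: | P[X_1 − X_3 + X_2 − X_4 ≥ Γ and X_1 − X_3 − X_2 + X_4 ≥ Γ] − g_γ(β, a_1, a_2, a_3, a_4) | ≤ C'/n. -/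

import Mathlib

open MeasureTheory ProbabilityTheory

/-- The law of a pair of independent standard Gaussians. -/
noncomputable def gauss2 : Measure (ℝ × ℝ) :=
  (gaussianReal 0 1).prod (gaussianReal 0 1)

/-- The Gaussian corner probability `g_γ(β, a₁, a₂, a₃, a₄)`. -/
noncomputable def gGauss (γ β a₁ a₂ a₃ a₄ : ℝ) : ℝ :=
  (gauss2 {p : ℝ × ℝ |
      γ + ((a₃ - a₁) * β + (a₄ - a₂) * (1 - β)) / 2 ≤
        Real.sqrt (β / 2) * p.1 + Real.sqrt ((1 - β) / 2) * p.2 ∧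
      γ + ((a₃ - a₁) * β - (a₄ - a₂) * (1 - β)) / 2 ≤
        Real.sqrt (β / 2) * p.1 - Real.sqrt ((1 - β) / 2) * p.2}).toReal

/-- The probability mass function of `Bin(m,p)` at `j`. -/
noncomputable def binomPMF (m : ℕ) (p : ℝ) (j : ℕ) : ℝ :=
  (m.choose j : ℝ) * p ^ j * (1 - p) ^ (m - j)

/-- `P[X₁ − X₃ + X₂ − X₄ ≥ Γ ∧ X₁ − X₃ − X₂ + X₄ ≥ Γ]` for independent
`X₁ ∼ Bin(k−1,p₁)`, `X₂ ∼ Bin(n−k,p₂)`, `X₃ ∼ Bin(k,p₃)`, `X₄ ∼ Bin(n−k,p₄)`. -/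
noncomputable def binomCornerProb (n k : ℕ) (p₁ p₂ p₃ p₄ : ℝ) (Γ : ℤ) : ℝ :=
  ∑ x₁ ∈ Finset.range k, ∑ x₂ ∈ Finset.range (n - k + 1),
    ∑ x₃ ∈ Finset.range (k + 1), ∑ x₄ ∈ Finset.range (n - k + 1),
      if Γ ≤ (x₁ : ℤ) - x₃ + x₂ - x₄ ∧ Γ ≤ (x₁ : ℤ) - x₃ - x₂ + x₄ then
        binomPMF (k - 1) p₁ x₁ * binomPMF (n - k) p₂ x₂ *
          binomPMF k p₃ x₃ * binomPMF (n - k) p₄ x₄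
      else 0

/-- The density at `x` of the Gaussian law with mean `μ` and variance `v`. -/
noncomputable def gaussDensity (μ v x : ℝ) : ℝ :=
  (Real.sqrt (2 * Real.pi * v))⁻¹ * Real.exp (-(x - μ) ^ 2 / (2 * v))

lemma gaussDensity_pos {v : ℝ} (hv : 0 < v) (μ x : ℝ) : 0 < gaussDensity μ v x := by
  unfold gaussDensity
  have := Real.pi_pos
  positivity

lemma integrable_gaussDensity {v : ℝ} (hv : 0 < v) (μ : ℝ) : Integrable (gaussDensity μ v) :=
  integrable_gaussianPDFReal μ ⟨v, hv.le⟩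

lemma integral_gaussDensity {v : ℝ} (hv : 0 < v) (μ : ℝ) : ∫ x, gaussDensity μ v x = 1 :=
  integral_gaussianPDFReal_eq_one μ (v := ⟨v, hv.le⟩) (by
    intro h; exact hv.ne' (congrArg NNReal.toReal h))

lemma gaussDensity_neg (μ v x : ℝ) : gaussDensity μ v (-x) = gaussDensity (-μ) v x := by
  unfold gaussDensity
  ring_nf

lemma hasDerivAt_gaussDensity {v : ℝ} (hv : 0 < v) (μ x : ℝ) :
    HasDerivAt (gaussDensity μ v) (-(x - μ) / v * gaussDensity μ v x) x := by
  unfold gaussDensity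
  have h : HasDerivAt (fun x : ℝ => -(x - μ) ^ 2 / (2 * v)) (-(x - μ) / v) x := by
    have := ((((hasDerivAt_id x).sub_const μ).pow 2).neg).div_const (2 * v)
    refine this.congr_deriv ?_
    simp; field_simp; ring
  exact (h.exp.const_mul _).congr_deriv (by ring)

lemma hasDerivAt_deriv_gaussDensity {v : ℝ} (hv : 0 < v) (μ x : ℝ) :
    HasDerivAt (fun x => -(x - μ) / v * gaussDensity μ v x)
      (((x - μ) ^ 2 / v - 1) / v * gaussDensity μ v x) x := by
  have h : HasDerivAt (fun x : ℝ => -(x - μ) / v) (-1 / v) x :=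
    (((hasDerivAt_id x).sub_const μ).neg).div_const v
  refine (h.mul (hasDerivAt_gaussDensity hv μ x)).congr_deriv ?_
  field_simp
  ring

lemma continuous_gaussDensity (μ v : ℝ) : Continuous (gaussDensity μ v) := by
  unfold gaussDensity
  fun_prop

lemma gaussDensity_eq_double {v : ℝ} (hv : 0 < v) (μ x : ℝ) :
    gaussDensity μ v x =
      Real.sqrt 2 * Real.exp (-((x - μ) ^ 2 / v) / 4) * gaussDensity μ (2 * v) x := by
  unfold gaussDensity
  have h1 : Real.sqrt (2 * Real.pi * (2 * v)) = Real.sqrt 2 * Real.sqrt (2 * Real.pi * v) := by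
    rw [← Real.sqrt_mul (by norm_num)]; ring_nf
  have h2 : Real.exp (-(x - μ) ^ 2 / (2 * v)) = Real.exp (-((x - μ) ^ 2 / v) / 4) *
      Real.exp (-(x - μ) ^ 2 / (2 * (2 * v))) := by
    rw [← Real.exp_add]; congr 1; field_simp; ring
  have h3 : Real.sqrt 2 ≠ 0 := by positivity
  rw [h1, h2, mul_inv]
  field_simp

lemma mul_gaussDensity_le_double {v : ℝ} (hv : 0 < v) (μ x : ℝ) {a c : ℝ} (hc : 0 ≤ c)
    (h : a ≤ c * Real.exp ((x - μ) ^ 2 / v / 4)) :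
    a * gaussDensity μ v x ≤ 2 * c * gaussDensity μ (2 * v) x := by
  have h4 := (gaussDensity_pos (v := 2 * v) (by positivity) μ x).le
  have h5 : a * Real.exp (-((x - μ) ^ 2 / v) / 4) ≤ c := by
    have := mul_le_mul_of_nonneg_right h (Real.exp_pos (-((x - μ) ^ 2 / v) / 4)).le
    rwa [mul_assoc, ← Real.exp_add, show (x - μ) ^ 2 / v / 4 + -((x - μ) ^ 2 / v) / 4 = 0 by ring,
      Real.exp_zero, mul_one] at this
  have h6 : Real.sqrt 2 ≤ 2 := by
    rw [Real.sqrt_le_left (by norm_num)]; norm_num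
  rw [gaussDensity_eq_double hv]
  calc a * (Real.sqrt 2 * Real.exp (-((x - μ) ^ 2 / v) / 4) * gaussDensity μ (2 * v) x)
      = (Real.sqrt 2 * (a * Real.exp (-((x - μ) ^ 2 / v) / 4))) * gaussDensity μ (2 * v) x := by
        ring
    _ ≤ (2 * c) * gaussDensity μ (2 * v) x := by
        apply mul_le_mul_of_nonneg_right _ h4
        calc _ ≤ Real.sqrt 2 * c := mul_le_mul_of_nonneg_left h5 (by positivity)
          _ ≤ 2 * c := mul_le_mul_of_nonneg_right h6 hc

lemma gaussDensity_le_double {v : ℝ} (hv : 0 < v) (μ x : ℝ) :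
    gaussDensity μ v x ≤ 2 * gaussDensity μ (2 * v) x := by
  have := mul_gaussDensity_le_double hv μ x (a := 1) (c := 1) zero_le_one
    (by rw [one_mul]; exact Real.one_le_exp (by positivity))
  simpa using this

lemma abs_deriv_gaussDensity_le_double {v : ℝ} (hv : 0 < v) (μ x : ℝ) :
    |-(x - μ) / v * gaussDensity μ v x| ≤ 6 / Real.sqrt v * gaussDensity μ (2 * v) x := by
  rw [abs_mul, abs_of_pos (gaussDensity_pos hv μ x), abs_div, abs_neg, abs_of_pos hv]
  have hs : 0 < Real.sqrt v := Real.sqrt_pos.2 hv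
  refine (mul_gaussDensity_le_double hv μ x (c := 3 / Real.sqrt v) (by positivity) ?_).trans
    (by apply le_of_eq; ring)
  set y := |x - μ| / Real.sqrt v with hy
  have hy0 : 0 ≤ y := by positivity
  have h1 : (x - μ) ^ 2 / v = y ^ 2 := by
    rw [hy, div_pow, sq_abs, Real.sq_sqrt hv.le]
  have h2 : |x - μ| / v = y / Real.sqrt v := by
    rw [hy, div_div, Real.mul_self_sqrt hv.le]
  rw [h1, h2, div_mul_eq_mul_div]
  gcongr
  have := Real.add_one_le_exp (y ^ 2 / 4)
  nlinarith [sq_nonneg (y - 2)]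

lemma abs_deriv_two_gaussDensity_le_double {v : ℝ} (hv : 0 < v) (μ x : ℝ) :
    |((x - μ) ^ 2 / v - 1) / v * gaussDensity μ v x| ≤ 8 / v * gaussDensity μ (2 * v) x := by
  rw [abs_mul, abs_of_pos (gaussDensity_pos hv μ x), abs_div, abs_of_pos hv]
  refine (mul_gaussDensity_le_double hv μ x (c := 4 / v) (by positivity) ?_).trans
    (by apply le_of_eq; ring)
  rw [div_mul_eq_mul_div]
  gcongr
  have h0 : 0 ≤ (x - μ) ^ 2 / v := by positivity
  have := Real.add_one_le_exp ((x - μ) ^ 2 / v / 4)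
  rw [abs_le]; constructor <;> linarith

lemma inv_sqrt_two_pi_mul_le {v : ℝ} (hv : 0 < v) :
    (Real.sqrt (2 * Real.pi * v))⁻¹ ≤ (Real.sqrt v)⁻¹ := by
  have := Real.pi_gt_three
  have hs : 0 < Real.sqrt v := Real.sqrt_pos.2 hv
  gcongr
  nlinarith

lemma gaussDensity_le {v : ℝ} (hv : 0 < v) (μ x : ℝ) :
    gaussDensity μ v x ≤ 1 / Real.sqrt v := by
  unfold gaussDensity
  have h1 := inv_sqrt_two_pi_mul_le hv
  have h2 : Real.exp (-(x - μ) ^ 2 / (2 * v)) ≤ 1 := by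
    rw [Real.exp_le_one_iff]
    exact div_nonpos_of_nonpos_of_nonneg (by nlinarith [sq_nonneg (x - μ)]) (by positivity)
  rw [one_div, ← mul_one (Real.sqrt v)⁻¹]
  gcongr

lemma abs_deriv_gaussDensity_le {v : ℝ} (hv : 0 < v) (μ x : ℝ) :
    |-(x - μ) / v * gaussDensity μ v x| ≤ 1 / v := by
  rw [abs_mul, abs_of_pos (gaussDensity_pos hv μ x), abs_div, abs_neg, abs_of_pos hv]
  have hs : 0 < Real.sqrt v := Real.sqrt_pos.2 hv
  unfold gaussDensity
  have h0 := inv_sqrt_two_pi_mul_le hv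
  set y := |x - μ| / Real.sqrt v with hy
  have hy0 : 0 ≤ y := by positivity
  have h1 : -(x - μ) ^ 2 / (2 * v) = -(y ^ 2 / 2) := by
    rw [hy, div_pow, sq_abs, Real.sq_sqrt hv.le]; field_simp
  have h2 : |x - μ| / v = y / Real.sqrt v := by
    rw [hy, div_div, Real.mul_self_sqrt hv.le]
  rw [h1, h2]
  have h3 : y * Real.exp (-(y ^ 2 / 2)) ≤ 1 := by
    rw [Real.exp_neg, ← div_eq_mul_inv, div_le_one (Real.exp_pos _)]
    have := Real.add_one_le_exp (y ^ 2 / 2)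
    nlinarith [sq_nonneg (y - 1)]
  calc y / Real.sqrt v * ((Real.sqrt (2 * Real.pi * v))⁻¹ * Real.exp (-(y ^ 2 / 2)))
      = (Real.sqrt v)⁻¹ * (Real.sqrt (2 * Real.pi * v))⁻¹ * (y * Real.exp (-(y ^ 2 / 2))) := by
        ring
    _ ≤ (Real.sqrt v)⁻¹ * (Real.sqrt v)⁻¹ * 1 := by gcongr
    _ = 1 / v := by rw [mul_one, ← mul_inv, Real.mul_self_sqrt hv.le, one_div]

lemma abs_sub_integral_cell_le {f f' f'' G : ℝ → ℝ} (hf : ∀ x, HasDerivAt f (f' x) x)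
    (hf' : ∀ x, HasDerivAt f' (f'' x) x) (hc : Continuous f'') (hG : Integrable G)
    (hb : ∀ x, |f'' x| ≤ G x) (a : ℝ) :
    |f a - ∫ x in (a - 1 / 2)..(a + 1 / 2), f x| ≤ ∫ x in (a - 1 / 2)..(a + 1 / 2), G x := by
  set M := ∫ x in (a - 1 / 2)..(a + 1 / 2), G x with hM
  have hG0 : ∀ x, 0 ≤ G x := fun x => (abs_nonneg _).trans (hb x)
  have hfc : Continuous f := continuous_iff_continuousAt.2 fun x => (hf x).continuousAt
  have hM0 : 0 ≤ M := intervalIntegral.integral_nonneg (by linarith) fun x _ => hG0 x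
  have h1 : ∀ x ∈ Set.Icc (a - 1 / 2) (a + 1 / 2), |f' x - f' a| ≤ M := by
    intro x hx
    rw [← intervalIntegral.integral_eq_sub_of_hasDerivAt (fun y _ => hf' y)
      (hc.intervalIntegrable _ _)]
    calc |∫ y in a..x, f'' y| = ‖∫ y in a..x, f'' y‖ := rfl
      _ ≤ ∫ y in Set.uIoc a x, ‖f'' y‖ := intervalIntegral.norm_integral_le_integral_norm_uIoc
      _ ≤ ∫ y in Set.uIoc a x, G y := by
          apply setIntegral_mono_on
          · exact (hc.norm.integrableOn_uIcc).mono_set Set.uIoc_subset_uIcc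
          · exact hG.integrableOn
          · exact measurableSet_uIoc
          · intro y _; exact hb y
      _ ≤ ∫ y in Set.Ioc (a - 1 / 2) (a + 1 / 2), G y := by
          apply setIntegral_mono_set hG.integrableOn
          · exact Filter.Eventually.of_forall hG0
          · apply LE.le.eventuallyLE
            intro y hy
            rw [Set.mem_uIoc] at hy
            have := hx.1
            have := hx.2
            constructor <;> rcases hy with hy | hy <;> linarith [hy.1, hy.2]
      _ = M := by rw [hM, intervalIntegral.integral_of_le (by linarith)]
  have h2 : ∀ x ∈ Set.Icc (a - 1 / 2) (a + 1 / 2), |f x - f a - f' a * (x - a)| ≤ M := by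
    intro x hx
    have := (convex_Icc (a - 1 / 2) (a + 1 / 2)).norm_image_sub_le_of_norm_hasDerivWithin_le
      (f := fun x => f x - f' a * (x - a)) (f' := fun x => f' x - f' a) (C := M)
      (fun y _ => by
        have h := (hf y).sub (((hasDerivAt_id y).sub_const a).const_mul (f' a))
        exact (h.congr_deriv (by simp)).hasDerivWithinAt)
      h1 (x := a) (y := x) ⟨by linarith, by linarith⟩ hx
    have h3 : ‖x - a‖ ≤ 1 := by
      rw [Real.norm_eq_abs, abs_le]; constructor <;> linarith [hx.1, hx.2]
    have h4 : f x - f a - f' a * (x - a) = f x - f' a * (x - a) - (f a - f' a * (a - a)) := by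
      ring
    rw [h4]
    calc _ ≤ M * ‖x - a‖ := this
      _ ≤ M * 1 := by gcongr
      _ = M := mul_one M
  have h5 : ∫ x in (a - 1 / 2)..(a + 1 / 2), (f x - f a - f' a * (x - a)) =
      (∫ x in (a - 1 / 2)..(a + 1 / 2), f x) - f a := by
    rw [intervalIntegral.integral_sub, intervalIntegral.integral_sub,
      intervalIntegral.integral_const_mul, intervalIntegral.integral_sub]
    · simp
      ring
    all_goals apply Continuous.intervalIntegrable; fun_prop
  rw [abs_sub_comm, ← h5]
  have := intervalIntegral.norm_integral_le_of_norm_le_const (a := a - 1 / 2) (b := a + 1 / 2)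
    (f := fun x => f x - f a - f' a * (x - a)) (C := M) (fun x hx => by
      rw [Set.uIoc_of_le (by linarith)] at hx
      exact h2 x ⟨hx.1.le, hx.2⟩)
  calc _ ≤ _ := this
    _ = M := by
      rw [show a + 1 / 2 - (a - 1 / 2) = 1 by ring]; simp

/-- The midpoint rule with unit step on a half-line. -/
lemma summable_and_abs_tsum_sub_integral_le {f f' f'' G : ℝ → ℝ}
    (hf : ∀ x, HasDerivAt f (f' x) x)
    (hf' : ∀ x, HasDerivAt f' (f'' x) x) (hc : Continuous f'') (hG : Integrable G)
    (hb : ∀ x, |f'' x| ≤ G x) (hf0 : ∀ x, 0 ≤ f x) (a : ℝ)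
    (hi : IntegrableOn f (Set.Ioi (a - 1 / 2))) :
    Summable (fun i : ℕ => f (a + i)) ∧
      |∑' i : ℕ, f (a + i) - ∫ x in Set.Ioi (a - 1 / 2), f x| ≤ ∫ x, G x := by
  have hG0 : ∀ x, 0 ≤ G x := fun x => (abs_nonneg _).trans (hb x)
  have hfc : Continuous f := continuous_iff_continuousAt.2 fun x => (hf x).continuousAt
  have key : ∀ N : ℕ, |∑ i ∈ Finset.range N, f (a + i) -
      ∫ x in (a - 1 / 2)..(a - 1 / 2 + N), f x| ≤ ∫ x, G x := by
    intro N
    have e : ∀ g : ℝ → ℝ, (∀ x y, IntervalIntegrable g volume x y) →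
        ∫ x in (a - 1 / 2)..(a - 1 / 2 + N), g x =
        ∑ i ∈ Finset.range N, ∫ x in (a + i - 1 / 2)..(a + i + 1 / 2), g x := by
      intro g hg
      have := intervalIntegral.sum_integral_adjacent_intervals (f := g) (μ := volume)
        (a := fun i : ℕ => a - 1 / 2 + i) (n := N) (fun k _ => hg _ _)
      rw [Nat.cast_zero, add_zero] at this
      rw [← this]
      refine Finset.sum_congr rfl fun i _ => ?_
      congr 1
      · ring
      · push_cast; ring
    rw [e f fun x y => hfc.intervalIntegrable _ _, ← Finset.sum_sub_distrib]
    calc _ ≤ ∑ i ∈ Finset.range N, |f (a + i) -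
          ∫ x in (a + i - 1 / 2)..(a + i + 1 / 2), f x| := Finset.abs_sum_le_sum_abs _ _
      _ ≤ ∑ i ∈ Finset.range N, ∫ x in (a + i - 1 / 2)..(a + i + 1 / 2), G x :=
          Finset.sum_le_sum fun i _ => abs_sub_integral_cell_le hf hf' hc hG hb _
      _ = ∫ x in (a - 1 / 2)..(a - 1 / 2 + N), G x :=
          (e G fun x y => hG.intervalIntegrable).symm
      _ ≤ ∫ x, G x := by
          rw [intervalIntegral.integral_of_le (by linarith [(Nat.cast_nonneg N : (0 : ℝ) ≤ N)])]
          exact setIntegral_le_integral hG (Filter.Eventually.of_forall hG0)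
  have hs : Summable (fun i : ℕ => f (a + i)) := by
    refine summable_of_sum_range_le (c := (∫ x in Set.Ioi (a - 1 / 2), f x) + ∫ x, G x)
      (fun i => hf0 _) fun N => ?_
    have h1 := (abs_le.1 (key N)).2
    have h2 : ∫ x in (a - 1 / 2)..(a - 1 / 2 + N), f x ≤ ∫ x in Set.Ioi (a - 1 / 2), f x := by
      rw [intervalIntegral.integral_of_le (by linarith [(Nat.cast_nonneg N : (0 : ℝ) ≤ N)])]
      exact setIntegral_mono_set hi (Filter.Eventually.of_forall hf0)
        Set.Ioc_subset_Ioi_self.eventuallyLE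
    linarith
  refine ⟨hs, ?_⟩
  have t1 := hs.hasSum.tendsto_sum_nat
  have t2 : Filter.Tendsto (fun N : ℕ => ∫ x in (a - 1 / 2)..(a - 1 / 2 + N), f x) Filter.atTop
      (nhds (∫ x in Set.Ioi (a - 1 / 2), f x)) :=
    intervalIntegral_tendsto_integral_Ioi _ hi
      (Filter.tendsto_atTop_add_const_left _ _ tendsto_natCast_atTop_atTop)
  exact le_of_tendsto (t1.sub t2).abs (Filter.Eventually.of_forall key)

lemma continuous_deriv_two_gaussDensity (μ v : ℝ) :
    Continuous fun x => ((x - μ) ^ 2 / v - 1) / v * gaussDensity μ v x :=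
  Continuous.mul (by fun_prop) (continuous_gaussDensity μ v)

lemma gaussDensity_half_line_sum {v : ℝ} (hv : 0 < v) (μ a : ℝ) :
    Summable (fun i : ℕ => gaussDensity μ v (a + i)) ∧
      |∑' i : ℕ, gaussDensity μ v (a + i) - ∫ x in Set.Ioi (a - 1 / 2), gaussDensity μ v x| ≤
        8 / v := by
  have hG := integrable_gaussDensity (v := 2 * v) (by positivity) μ
  have h := summable_and_abs_tsum_sub_integral_le (hasDerivAt_gaussDensity hv μ)
    (hasDerivAt_deriv_gaussDensity hv μ) (continuous_deriv_two_gaussDensity μ v)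
    (hG.const_mul (8 / v)) (abs_deriv_two_gaussDensity_le_double hv μ)
    (fun x => (gaussDensity_pos hv μ x).le) a (integrable_gaussDensity hv μ).integrableOn
  rwa [integral_const_mul, integral_gaussDensity (by positivity), mul_one] at h

lemma summable_gaussDensity_int {v : ℝ} (hv : 0 < v) (μ : ℝ) :
    Summable (fun j : ℤ => gaussDensity μ v j) := by
  apply Summable.of_nat_of_neg_add_one
  · simpa using (gaussDensity_half_line_sum hv μ 0).1
  · have := (gaussDensity_half_line_sum hv (-μ) 1).1
    refine this.congr fun i => ?_
    rw [← gaussDensity_neg]; push_cast; ring_nf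

lemma abs_tsum_gaussDensity_int_sub_one_le {v : ℝ} (hv : 0 < v) (μ : ℝ) :
    |∑' j : ℤ, gaussDensity μ v j - 1| ≤ 16 / v := by
  obtain ⟨s1, h1⟩ := gaussDensity_half_line_sum hv μ 0
  obtain ⟨s2, h2⟩ := gaussDensity_half_line_sum hv (-μ) 1
  have e2 : ∀ i : ℕ, gaussDensity (-μ) v (1 + i) =
      gaussDensity μ v ((-((i : ℤ) + 1) : ℤ) : ℝ) := by
    intro i
    rw [← gaussDensity_neg]; push_cast; ring_nf
  have e3 : ∫ x in Set.Ioi ((1 : ℝ) - 1 / 2), gaussDensity (-μ) v x =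
      ∫ x in Set.Iic (-(1 / 2) : ℝ), gaussDensity μ v x := by
    rw [← integral_comp_neg_Ioi]
    simp_rw [gaussDensity_neg]
    norm_num
  have e4 := intervalIntegral.integral_Iic_add_Ioi (b := (-(1 / 2) : ℝ))
    (integrable_gaussDensity hv μ).integrableOn (integrable_gaussDensity hv μ).integrableOn
  rw [integral_gaussDensity hv] at e4
  rw [e3] at h2
  simp_rw [e2] at h2 s2
  simp only [zero_add, zero_sub] at h1 s1
  rw [tsum_of_nat_of_neg_add_one (f := fun j : ℤ => gaussDensity μ v j)
    (by simpa using s1) s2]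
  simp only [Int.cast_natCast]
  rw [abs_le] at *
  have : 16 / v = 8 / v + 8 / v := by ring
  constructor <;> linarith [h1.1, h1.2, h2.1, h2.2]

lemma tsum_gaussDensity_int_le {v : ℝ} (hv : 16 ≤ v) (μ : ℝ) :
    ∑' j : ℤ, gaussDensity μ v j ≤ 2 := by
  have h := (abs_le.1 (abs_tsum_gaussDensity_int_sub_one_le (by linarith : 0 < v) μ)).2
  have : 16 / v ≤ 1 := by rw [div_le_one (by linarith)]; exact hv
  linarith

/-- The upper tail of the Gaussian law with mean `μ` and variance `v`. -/
noncomputable def gaussTail (μ v z : ℝ) : ℝ := ∫ x in Set.Ioi z, gaussDensity μ v x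

lemma gaussTail_nonneg {v : ℝ} (hv : 0 < v) (μ z : ℝ) : 0 ≤ gaussTail μ v z :=
  integral_nonneg fun x => (gaussDensity_pos hv μ x).le

lemma gaussTail_le_one {v : ℝ} (hv : 0 < v) (μ z : ℝ) : gaussTail μ v z ≤ 1 := by
  rw [← integral_gaussDensity hv μ]
  exact setIntegral_le_integral (integrable_gaussDensity hv μ)
    (Filter.Eventually.of_forall fun x => (gaussDensity_pos hv μ x).le)

lemma hasDerivAt_gaussTail {v : ℝ} (hv : 0 < v) (μ z : ℝ) :
    HasDerivAt (gaussTail μ v) (-gaussDensity μ v z) z := by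
  have hi := integrable_gaussDensity hv μ
  have e : gaussTail μ v = fun z => gaussTail μ v 0 - ∫ x in (0 : ℝ)..z, gaussDensity μ v x := by
    funext z
    unfold gaussTail
    rw [← intervalIntegral.integral_Ioi_sub_Ioi' hi.integrableOn hi.integrableOn]
    ring
  rw [e]
  have := (continuous_gaussDensity μ v).integral_hasStrictDerivAt 0 z
  simpa using this.hasDerivAt.const_sub (gaussTail μ v 0)

lemma abs_tsum_indicator_sub_gaussTail_le {v : ℝ} (hv : 0 < v) (μ : ℝ) (m : ℤ) :
    |∑' j : ℤ, gaussDensity μ v j * (if m ≤ j then 1 else 0) - gaussTail μ v (m - 1 / 2)| ≤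
      8 / v := by
  have hinj : Function.Injective fun i : ℕ => m + (i : ℤ) := by
    intro i j h; simpa using h
  rw [← hinj.tsum_eq]
  · have := (gaussDensity_half_line_sum hv μ m).2
    unfold gaussTail
    simpa using this
  · intro j hj
    have : m ≤ j := by
      by_contra h
      exact hj (by simp [h])
    exact ⟨(j - m).toNat, by simp; omega⟩

lemma abs_half_add_tsum_sub_integral_le {L v w : ℝ} (hL : 0 < L) (hv : L ≤ v) (hw : L ≤ w)
    (μ ν c : ℝ) :
    Summable (fun i : ℕ => gaussDensity μ v (1 + i) * gaussTail ν w (c + (1 + i))) ∧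
    |gaussDensity μ v 0 * gaussTail ν w c / 2 +
      ∑' i : ℕ, gaussDensity μ v (1 + i) * gaussTail ν w (c + (1 + i)) -
      ∫ y in Set.Ioi 0, gaussDensity μ v y * gaussTail ν w (c + y)| ≤ 24 / L := by
  have hv0 : 0 < v := hL.trans_le hv
  have hw0 : 0 < w := hL.trans_le hw
  have hsv : 0 < Real.sqrt v := Real.sqrt_pos.2 hv0
  have hsw : 0 < Real.sqrt w := Real.sqrt_pos.2 hw0
  have hsL : 0 < Real.sqrt L := Real.sqrt_pos.2 hL
  have hvw : 1 / Real.sqrt v * (1 / Real.sqrt w) ≤ 1 / L := by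
    rw [div_mul_div_comm, one_mul]
    apply one_div_le_one_div_of_le hL
    calc L = Real.sqrt L * Real.sqrt L := (Real.mul_self_sqrt hL.le).symm
      _ ≤ _ := by gcongr
  set h := gaussDensity μ v with hh
  set f := gaussDensity ν w with hf
  set T := gaussTail ν w with hT
  set h1 := fun x => -(x - μ) / v * h x with hh1
  set h2 := fun x => ((x - μ) ^ 2 / v - 1) / v * h x with hh2
  set f1 := fun x => -(x - ν) / w * f x with hf1
  have dh : ∀ x, HasDerivAt h (h1 x) x := hasDerivAt_gaussDensity hv0 μ
  have dh1 : ∀ x, HasDerivAt h1 (h2 x) x := hasDerivAt_deriv_gaussDensity hv0 μ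
  have df : ∀ x, HasDerivAt (fun x => f (c + x)) (f1 (c + x)) x := fun x =>
    (hasDerivAt_gaussDensity hw0 ν (c + x)).comp_const_add c x
  have dT : ∀ x, HasDerivAt (fun x => T (c + x)) (-f (c + x)) x := fun x =>
    (hasDerivAt_gaussTail hw0 ν (c + x)).comp_const_add c x
  set q := fun y => h y * T (c + y) with hq
  set q1 := fun y => h1 y * T (c + y) + h y * -f (c + y) with hq1
  set q2 := fun y => (h2 y * T (c + y) + h1 y * -f (c + y)) +
    (h1 y * -f (c + y) + h y * -f1 (c + y)) with hq2
  have dq : ∀ x, HasDerivAt q (q1 x) x := fun x => (dh x).mul (dT x)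
  have dq1 : ∀ x, HasDerivAt q1 (q2 x) x := fun x =>
    ((dh1 x).mul (dT x)).add ((dh x).mul (df x).neg)
  have ch : Continuous h := continuous_gaussDensity μ v
  have cf : Continuous f := continuous_gaussDensity ν w
  have cT : Continuous T :=
    continuous_iff_continuousAt.2 fun x => (hasDerivAt_gaussTail hw0 ν x).continuousAt
  have ch1 : Continuous h1 := continuous_iff_continuousAt.2 fun x => (dh1 x).continuousAt
  have ch2 : Continuous h2 := continuous_deriv_two_gaussDensity μ v
  have cf1 : Continuous f1 :=
    continuous_iff_continuousAt.2 fun x => (hasDerivAt_deriv_gaussDensity hw0 ν x).continuousAt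
  have cq2 : Continuous q2 := by fun_prop
  have cq : Continuous q := by fun_prop
  have T0 : ∀ z, 0 ≤ T z := gaussTail_nonneg hw0 ν
  have T1 : ∀ z, T z ≤ 1 := gaussTail_le_one hw0 ν
  have h0 : ∀ x, 0 < h x := gaussDensity_pos hv0 μ
  have f0 : ∀ x, 0 < f x := gaussDensity_pos hw0 ν
  have fb : ∀ x, f x ≤ 1 / Real.sqrt w := gaussDensity_le hw0 ν
  have hb : ∀ x, h x ≤ 1 / Real.sqrt v := gaussDensity_le hv0 μ
  have f1b : ∀ x, |f1 x| ≤ 1 / w := abs_deriv_gaussDensity_le hw0 ν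
  have h1b : ∀ x, |h1 x| ≤ 1 / v := abs_deriv_gaussDensity_le hv0 μ
  set G := gaussDensity μ (2 * v) with hG
  have hGi : Integrable G := integrable_gaussDensity (by positivity) μ
  have G0 : ∀ x, 0 < G x := gaussDensity_pos (by positivity) μ
  have hG1 : ∀ x, h x ≤ 2 * G x := gaussDensity_le_double hv0 μ
  have h1G : ∀ x, |h1 x| ≤ 6 / Real.sqrt v * G x := abs_deriv_gaussDensity_le_double hv0 μ
  have h2G : ∀ x, |h2 x| ≤ 8 / v * G x := abs_deriv_two_gaussDensity_le_double hv0 μ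
  have iv : 1 / v ≤ 1 / L := one_div_le_one_div_of_le hL hv
  have iw : 1 / w ≤ 1 / L := one_div_le_one_div_of_le hL hw
  have hq2b : ∀ x, |q2 x| ≤ 22 / L * G x := by
    intro x
    have a1 : |h2 x * T (c + x)| ≤ 8 / L * G x := by
      rw [abs_mul, abs_of_nonneg (T0 _)]
      calc |h2 x| * T (c + x) ≤ |h2 x| * 1 := by gcongr; exact T1 _
        _ ≤ 8 / v * G x := by rw [mul_one]; exact h2G x
        _ ≤ 8 / L * G x := by gcongr; exact (G0 x).le
    have a2 : |h1 x * -f (c + x)| ≤ 6 / L * G x := by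
      rw [abs_mul, abs_neg, abs_of_pos (f0 _)]
      calc |h1 x| * f (c + x) ≤ (6 / Real.sqrt v * G x) * (1 / Real.sqrt w) := by
            gcongr
            · exact (f0 _).le
            · have := G0 x; positivity
            · exact h1G x
            · exact fb _
        _ = 6 * (1 / Real.sqrt v * (1 / Real.sqrt w)) * G x := by ring
        _ ≤ 6 * (1 / L) * G x := by gcongr; exact (G0 x).le
        _ = _ := by ring
    have a3 : |h x * -f1 (c + x)| ≤ 2 / L * G x := by
      rw [abs_mul, abs_neg, abs_of_pos (h0 _)]
      calc h x * |f1 (c + x)| ≤ (2 * G x) * (1 / L) := by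
            gcongr
            · have := G0 x; positivity
            · exact hG1 x
            · exact (f1b _).trans iw
        _ = _ := by ring
    have : 22 / L * G x = 8 / L * G x + 6 / L * G x + (6 / L * G x + 2 / L * G x) := by ring
    rw [this]
    refine (abs_add_le _ _).trans (add_le_add ((abs_add_le _ _).trans (add_le_add a1 a2))
      ((abs_add_le _ _).trans (add_le_add a2 a3)))
  have hq1b : ∀ x, |q1 x| ≤ 2 / L := by
    intro x
    have a1 : |h1 x * T (c + x)| ≤ 1 / L := by
      rw [abs_mul, abs_of_nonneg (T0 _)]
      calc |h1 x| * T (c + x) ≤ |h1 x| * 1 := by gcongr; exact T1 _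
        _ ≤ 1 / L := by rw [mul_one]; exact (h1b x).trans iv
    have a2 : |h x * -f (c + x)| ≤ 1 / L := by
      rw [abs_mul, abs_neg, abs_of_pos (f0 _), abs_of_pos (h0 _)]
      refine le_trans ?_ hvw
      gcongr
      · exact (f0 _).le
      · exact hb x
      · exact fb _
    rw [show 2 / L = 1 / L + 1 / L by ring]
    exact (abs_add_le _ _).trans (add_le_add a1 a2)
  have hqi : Integrable q := by
    refine (integrable_gaussDensity hv0 μ).mono' cq.aestronglyMeasurable
      (Filter.Eventually.of_forall fun x => ?_)
    rw [Real.norm_eq_abs, abs_mul, abs_of_nonneg (T0 _), abs_of_pos (h0 _)]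
    exact mul_le_of_le_one_right (h0 x).le (T1 _)
  obtain ⟨s, hs⟩ := summable_and_abs_tsum_sub_integral_le dq dq1 cq2 (hGi.const_mul (22 / L)) hq2b
    (fun x => mul_nonneg (h0 x).le (T0 _)) 1 hqi.integrableOn
  rw [integral_const_mul, integral_gaussDensity (by positivity), mul_one] at hs
  refine ⟨s, ?_⟩
  have e0 : |q 0 / 2 - ∫ y in (0 : ℝ)..(1 / 2), q y| ≤ 2 / L := by
    have hd : ∀ y ∈ Set.uIoc (0 : ℝ) (1 / 2), ‖q 0 - q y‖ ≤ 2 / L := by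
      intro y hy
      rw [Set.uIoc_of_le (by norm_num)] at hy
      have := (convex_univ).norm_image_sub_le_of_norm_hasDerivWithin_le
        (f := q) (f' := q1) (C := 2 / L) (fun y _ => (dq y).hasDerivWithinAt)
        (fun y _ => hq1b y) (Set.mem_univ y) (Set.mem_univ 0)
      refine this.trans ?_
      rw [zero_sub, norm_neg, Real.norm_eq_abs, abs_of_pos hy.1]
      exact mul_le_of_le_one_right (by positivity) (by linarith [hy.2])
    have := intervalIntegral.norm_integral_le_of_norm_le_const hd
    rw [intervalIntegral.integral_sub (by simp) (cq.intervalIntegrable _ _)] at this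
    simp only [intervalIntegral.integral_const, sub_zero, smul_eq_mul] at this
    rw [Real.norm_eq_abs, abs_of_pos (by norm_num : (0 : ℝ) < 1 / 2)] at this
    have e : q 0 / 2 = 1 / 2 * q 0 := by ring
    rw [e]
    refine this.trans ?_
    have : 0 < 2 / L := by positivity
    linarith
  have e1 := intervalIntegral.integral_Ioi_sub_Ioi' (a := 0) (b := 1 / 2)
    (hqi.integrableOn) hqi.integrableOn
  have e2 : h 0 * T c = q 0 := by simp [hq]
  rw [e2]
  rw [show (1 : ℝ) - 1 / 2 = 1 / 2 by norm_num] at hs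
  have e3 : 24 / L = 22 / L + 2 / L := by ring
  rw [abs_le] at *
  change -(24 / L) ≤ q 0 / 2 + ∑' i : ℕ, q (1 + i) - ∫ y in Set.Ioi 0, q y ∧
    q 0 / 2 + ∑' i : ℕ, q (1 + i) - ∫ y in Set.Ioi 0, q y ≤ 24 / L
  constructor <;> linarith [hs.1, hs.2, e0.1, e0.2]

lemma continuous_gaussTail {v : ℝ} (hv : 0 < v) (μ : ℝ) : Continuous (gaussTail μ v) :=
  continuous_iff_continuousAt.2 fun x => (hasDerivAt_gaussTail hv μ x).continuousAt

lemma abs_tsum_mul_gaussTail_abs_sub_integral_le {L v w : ℝ} (hL : 0 < L) (hv : L ≤ v)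
    (hw : L ≤ w) (μ ν c : ℝ) :
    |∑' e : ℤ, gaussDensity μ v e * gaussTail ν w (c + |(e : ℝ)|) -
      ∫ y, gaussDensity μ v y * gaussTail ν w (c + |y|)| ≤ 48 / L := by
  have hv0 : 0 < v := hL.trans_le hv
  have hw0 : 0 < w := hL.trans_le hw
  obtain ⟨s1, h1⟩ := abs_half_add_tsum_sub_integral_le hL hv hw μ ν c
  obtain ⟨s2, h2⟩ := abs_half_add_tsum_sub_integral_le hL hv hw (-μ) ν c
  have e1 : ∀ i : ℕ, gaussDensity μ v (1 + i) * gaussTail ν w (c + (1 + i)) =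
      gaussDensity μ v (((i : ℤ) + 1 : ℤ) : ℝ) *
        gaussTail ν w (c + |(((i : ℤ) + 1 : ℤ) : ℝ)|) := by
    intro i
    have : (0 : ℝ) ≤ (i : ℝ) + 1 := by positivity
    push_cast
    rw [abs_of_nonneg this, add_comm (1 : ℝ)]
  have e2 : ∀ i : ℕ, gaussDensity (-μ) v (1 + i) * gaussTail ν w (c + (1 + i)) =
      gaussDensity μ v ((-((i : ℤ) + 1) : ℤ) : ℝ) *
        gaussTail ν w (c + |((-((i : ℤ) + 1) : ℤ) : ℝ)|) := by
    intro i
    have : (0 : ℝ) ≤ (i : ℝ) + 1 := by positivity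
    rw [← gaussDensity_neg]
    push_cast
    rw [abs_neg, abs_of_nonneg this, add_comm (1 : ℝ)]
  simp_rw [e1] at s1 h1
  simp_rw [e2] at s2 h2
  rw [tsum_of_add_one_of_neg_add_one
    (f := fun e : ℤ => gaussDensity μ v e * gaussTail ν w (c + |(e : ℝ)|)) s1 s2]
  have hqi : Integrable fun y => gaussDensity μ v y * gaussTail ν w (c + |y|) := by
    refine (integrable_gaussDensity hv0 μ).mono'
      (((continuous_gaussDensity μ v).mul ((continuous_gaussTail hw0 ν).comp
        (by fun_prop))).aestronglyMeasurable) (Filter.Eventually.of_forall fun x => ?_)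
    rw [Real.norm_eq_abs, abs_mul, abs_of_nonneg (gaussTail_nonneg hw0 _ _),
      abs_of_pos (gaussDensity_pos hv0 _ _)]
    exact mul_le_of_le_one_right (gaussDensity_pos hv0 _ _).le (gaussTail_le_one hw0 _ _)
  have e4 := intervalIntegral.integral_Iic_add_Ioi (b := (0 : ℝ)) hqi.integrableOn
    hqi.integrableOn
  have e5 : ∫ y in Set.Ioi 0, gaussDensity μ v y * gaussTail ν w (c + y) =
      ∫ y in Set.Ioi 0, gaussDensity μ v y * gaussTail ν w (c + |y|) :=
    setIntegral_congr_fun measurableSet_Ioi fun y hy => by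
      rw [abs_of_pos hy]
  have e6 : ∫ y in Set.Ioi 0, gaussDensity (-μ) v y * gaussTail ν w (c + y) =
      ∫ y in Set.Iic 0, gaussDensity μ v y * gaussTail ν w (c + |y|) := by
    have := integral_comp_neg_Ioi 0 (fun y => gaussDensity μ v y * gaussTail ν w (c + |y|))
    rw [neg_zero] at this
    rw [← this]
    refine setIntegral_congr_fun measurableSet_Ioi fun y hy => ?_
    rw [gaussDensity_neg, abs_neg, abs_of_pos hy]
  have e7 : gaussDensity (-μ) v 0 = gaussDensity μ v 0 := by
    rw [← gaussDensity_neg, neg_zero]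
  rw [e5] at h1
  rw [e6, e7] at h2
  rw [← e4]
  simp only [Int.cast_zero, abs_zero, add_zero]
  have e8 : 48 / L = 24 / L + 24 / L := by ring
  rw [abs_le] at *
  constructor <;> linarith [h1.1, h1.2, h2.1, h2.2]

lemma two_mul_le_log_one_add_sub_log_one_sub {t : ℝ} (h0 : 0 ≤ t) (h1 : t < 1) :
    2 * t ≤ Real.log (1 + t) - Real.log (1 - t) := by
  have := Real.sum_range_le_log_div h0 h1 1
  rw [Real.log_div (by linarith) (by linarith)] at this
  simp at this
  linarith

lemma log_one_add_sub_log_one_sub_le {t : ℝ} (h0 : 0 ≤ t) (h1 : t ≤ 1 / 2) :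
    Real.log (1 + t) - Real.log (1 - t) ≤ 2 * t + 3 * t ^ 3 := by
  have := Real.log_div_le_sum_range_add h0 (by linarith) 1
  rw [Real.log_div (by linarith) (by linarith)] at this
  simp at this
  have h2 : t ^ 3 / (1 - t ^ 2) ≤ 3 / 2 * t ^ 3 := by
    rw [div_le_iff₀ (by nlinarith)]
    have : 0 ≤ t ^ 3 := by positivity
    nlinarith [mul_nonneg this (show 0 ≤ 1 / 4 - t ^ 2 by nlinarith)]
  linarith

lemma abs_log_one_add_sub_log_one_sub_sub_le {α : ℝ} (h : |α| ≤ 1 / 2) :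
    |Real.log (1 + α) - Real.log (1 - α) - 2 * α| ≤ 3 * |α| ^ 3 := by
  rcases le_total 0 α with h0 | h0
  · rw [abs_of_nonneg h0] at *
    have h1 := two_mul_le_log_one_add_sub_log_one_sub h0 (by linarith)
    have h2 := log_one_add_sub_log_one_sub_le h0 h
    have : 0 ≤ α ^ 3 := by positivity
    rw [abs_le]; constructor <;> linarith
  · rw [abs_of_nonpos h0] at *
    have h1 := two_mul_le_log_one_add_sub_log_one_sub (t := -α) (by linarith) (by linarith)
    have h2 := log_one_add_sub_log_one_sub_le (t := -α) (by linarith) h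
    have : 0 ≤ (-α) ^ 3 := by have : 0 ≤ -α := by linarith
                              positivity
    rw [sub_neg_eq_add, ← sub_eq_add_neg] at h1 h2
    rw [abs_le]; constructor <;> linarith

lemma binomPMF_pos {m j : ℕ} (hj : j ≤ m) {α : ℝ} (hα : |α| ≤ 1 / 2) :
    0 < binomPMF m (1 / 2 + α / 2) j := by
  rw [abs_le] at hα
  unfold binomPMF
  have h1 : 0 < 1 / 2 + α / 2 := by linarith
  have h2 : 0 < 1 - (1 / 2 + α / 2) := by linarith
  have h3 := Nat.choose_pos hj
  positivity

lemma binomPMF_succ {m j : ℕ} (hj : j < m) (p : ℝ) :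
    binomPMF m p (j + 1) * ((j + 1) * (1 - p)) = binomPMF m p j * ((m - j) * p) := by
  unfold binomPMF
  have h := congrArg (Nat.cast : ℕ → ℝ) (Nat.choose_succ_right_eq m j)
  push_cast [Nat.cast_sub hj.le] at h
  rw [show m - j = (m - (j + 1)) + 1 by omega, pow_succ, pow_succ]
  linear_combination (p ^ j * p * (1 - p) ^ (m - (j + 1)) * (1 - p)) * h

/-- The logarithm of the ratio of a binomial mass function and the Gaussian density. -/
noncomputable def logRatio (k m : ℕ) (α : ℝ) (j : ℕ) : ℝ :=
  Real.log (binomPMF m (1 / 2 + α / 2) j) -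
    Real.log (gaussDensity (m / 2 + α * k / 2) (k / 4) j)

lemma log_gaussDensity_sub {v : ℝ} (hv : 0 < v) (μ x y : ℝ) :
    Real.log (gaussDensity μ v x) - Real.log (gaussDensity μ v y) =
      ((y - μ) ^ 2 - (x - μ) ^ 2) / (2 * v) := by
  unfold gaussDensity
  have : (Real.sqrt (2 * Real.pi * v))⁻¹ ≠ 0 := by
    have := Real.pi_pos
    positivity
  rw [Real.log_mul this (Real.exp_ne_zero _), Real.log_mul this (Real.exp_ne_zero _),
    Real.log_exp, Real.log_exp]
  ring

lemma logRatio_succ_sub {k m j : ℕ} (hk : 0 < k) (hj : j < m) {α : ℝ} (hα : |α| ≤ 1 / 2) {x t : ℝ}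
    (hx : x = j + 1 / 2 - m / 2) (ht : t = 2 * x / (m + 1)) :
    logRatio k m α (j + 1) - logRatio k m α j =
      (Real.log (1 + α) - Real.log (1 - α) - 2 * α) + 4 * x * (1 / k - 1 / (m + 1)) -
      (Real.log (1 + t) - Real.log (1 - t) - 2 * t) := by
  have hk' : (0 : ℝ) < k := by exact_mod_cast hk
  have hm : (0 : ℝ) < m + 1 := by positivity
  have hjm : (j : ℝ) + 1 ≤ m := by exact_mod_cast hj
  have hb := binomPMF_succ hj (1 / 2 + α / 2)
  have p1 := binomPMF_pos (m := m) (j := j + 1) hj hα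
  have p0 := binomPMF_pos (m := m) (j := j) hj.le hα
  have hα' := abs_le.1 hα
  have e1 : 1 + t = (j + 1) * (2 / (m + 1)) := by
    rw [ht, hx]; field_simp; ring
  have e2 : 1 - t = (m - j) * (2 / (m + 1)) := by
    rw [ht, hx]; field_simp; ring
  have hl := congrArg Real.log hb
  have hj0 : (0 : ℝ) < (j : ℝ) + 1 := by positivity
  have hmj : (0 : ℝ) < (m : ℝ) - j := by linarith
  have ha1 : 0 < 1 + α := by linarith
  have ha2 : 0 < 1 - α := by linarith
  have e3 : 1 / 2 + α / 2 = (1 + α) * (1 / 2) := by ring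
  have e4 : 1 - (1 / 2 + α / 2) = (1 - α) * (1 / 2) := by ring
  rw [Real.log_mul p1.ne' (by rw [e4]; positivity), Real.log_mul p0.ne' (by rw [e3]; positivity),
    Real.log_mul hj0.ne' (by rw [e4]; positivity), Real.log_mul hmj.ne' (by rw [e3]; positivity),
    e4] at hl
  rw [show Real.log (1 / 2 + α / 2) = Real.log ((1 + α) * (1 / 2)) by rw [e3],
    Real.log_mul ha1.ne' (by norm_num), Real.log_mul ha2.ne' (by norm_num)] at hl
  rw [e1, e2, Real.log_mul hj0.ne' (by positivity), Real.log_mul hmj.ne' (by positivity)]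
  have hg := log_gaussDensity_sub (v := (k : ℝ) / 4) (by positivity) (m / 2 + α * k / 2)
    ((j + 1 : ℕ) : ℝ) (j : ℝ)
  have hg2 : (((j : ℝ) - (m / 2 + α * k / 2)) ^ 2 -
      (((j + 1 : ℕ) : ℝ) - (m / 2 + α * k / 2)) ^ 2) / (2 * ((k : ℝ) / 4)) =
      2 * α - 4 * x / k := by
    rw [hx]; push_cast; field_simp; ring
  rw [hg2] at hg
  have e5 : 4 * x * (1 / (k : ℝ) - 1 / (m + 1)) = 4 * x / k - 2 * t := by
    rw [ht]; ring
  rw [e5]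
  unfold logRatio
  linarith

lemma logRatio_succ_sub_bounds {k m j : ℕ} (hk : 0 < k) (hmk : m ≤ k) (hkm : k ≤ m + 1)
    (hj : j < m) (hmj : m ≤ 2 * j + 1) {α : ℝ} (hα : |α| ≤ 1 / 2) {x : ℝ}
    (hx : x = j + 1 / 2 - m / 2) :
    logRatio k m α (j + 1) - logRatio k m α j ≤ 3 * |α| ^ 3 + 4 * x / k ^ 2 ∧
    (4 * x ≤ m + 1 → |logRatio k m α (j + 1) - logRatio k m α j| ≤
      3 * |α| ^ 3 + 4 * x / k ^ 2 + 24 * x ^ 3 / k ^ 3) := by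
  have hk' : (0 : ℝ) < k := by exact_mod_cast hk
  have hm : (0 : ℝ) < (m : ℝ) + 1 := by positivity
  have hjm : (j : ℝ) + 1 ≤ m := by exact_mod_cast hj
  have hkm' : (k : ℝ) ≤ m + 1 := by exact_mod_cast hkm
  have hmj' : (m : ℝ) ≤ 2 * j + 1 := by exact_mod_cast hmj
  have hmk' : (m : ℝ) ≤ k := by exact_mod_cast hmk
  have hx0 : 0 ≤ x := by rw [hx]; linarith
  rw [logRatio_succ_sub hk hj hα hx rfl]
  set t := 2 * x / ((m : ℝ) + 1) with ht
  have ht0 : 0 ≤ t := by positivity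
  have ht1 : t < 1 := by rw [ht, div_lt_one hm, hx]; linarith
  have h1 := two_mul_le_log_one_add_sub_log_one_sub ht0 ht1
  have h2 := abs_log_one_add_sub_log_one_sub_sub_le hα
  rw [abs_le] at h2
  have h3 : 0 ≤ 4 * x * (1 / (k : ℝ) - 1 / (m + 1)) :=
    mul_nonneg (by positivity) (sub_nonneg.2 (one_div_le_one_div_of_le hk' hkm'))
  have h4 : 4 * x * (1 / (k : ℝ) - 1 / (m + 1)) ≤ 4 * x / k ^ 2 := by
    rw [← mul_one_div (4 * x) ((k : ℝ) ^ 2)]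
    refine mul_le_mul_of_nonneg_left ?_ (by positivity)
    rw [div_sub_div _ _ hk'.ne' hm.ne', div_le_div_iff₀ (by positivity) (by positivity)]
    have : (m : ℝ) + 1 - k ≤ 1 := by linarith
    nlinarith [mul_le_mul_of_nonneg_left hkm' hk'.le, sq_nonneg (k : ℝ),
      mul_le_mul_of_nonneg_right this (sq_nonneg (k : ℝ))]
  constructor
  · linarith [h2.2]
  · intro hx4
    have ht2 : t ≤ 1 / 2 := by rw [ht, div_le_iff₀ hm]; linarith
    have h5 := log_one_add_sub_log_one_sub_le ht0 ht2
    have h6 : 3 * t ^ 3 ≤ 24 * x ^ 3 / k ^ 3 := by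
      have : t ≤ 2 * x / k := by rw [ht]; gcongr
      calc 3 * t ^ 3 ≤ 3 * (2 * x / k) ^ 3 := by gcongr
        _ = _ := by ring
    rw [abs_le]
    have : 0 ≤ 24 * x ^ 3 / (k : ℝ) ^ 3 := by positivity
    constructor <;> linarith [h2.1, h2.2]

lemma logRatio_sub_bounds {k m j₀ j : ℕ} (hk : 0 < k) (hmk : m ≤ k) (hkm : k ≤ m + 1)
    (h₀ : m ≤ 2 * j₀ + 1) (hj₀ : j₀ ≤ j) (hj : j ≤ m) {α : ℝ}
    (hα : |α| ≤ 1 / 2) {U : ℝ} (hU : U = |(j : ℝ) - m / 2|) :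
    logRatio k m α j - logRatio k m α j₀ ≤ 2 * U * (3 * |α| ^ 3 + 4 * U / k ^ 2) ∧
    (4 * U ≤ m + 1 → |logRatio k m α j - logRatio k m α j₀| ≤
      2 * U * (3 * |α| ^ 3 + 4 * U / k ^ 2 + 24 * U ^ 3 / k ^ 3)) := by
  obtain ⟨N, rfl⟩ := Nat.exists_eq_add_of_le hj₀
  have hU0 : 0 ≤ U := hU ▸ abs_nonneg _
  have h₀r : (m : ℝ) ≤ 2 * j₀ + 1 := by exact_mod_cast h₀
  have hNU : (N : ℝ) ≤ 2 * U := by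
    rcases Nat.eq_zero_or_pos N with rfl | hN
    · simpa using hU0
    · have hN' : (1 : ℝ) ≤ N := by exact_mod_cast hN
      have : ((j₀ + N : ℕ) : ℝ) - m / 2 ≤ U := hU ▸ le_abs_self _
      push_cast at this
      linarith
  have hxU : ∀ i < N, 0 ≤ ((j₀ + i : ℕ) : ℝ) + 1 / 2 - m / 2 ∧
      ((j₀ + i : ℕ) : ℝ) + 1 / 2 - m / 2 ≤ U := by
    intro i hi
    have hi' : (i : ℝ) + 1 ≤ N := by exact_mod_cast hi
    have : ((j₀ + N : ℕ) : ℝ) - m / 2 ≤ U := hU ▸ le_abs_self _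
    have hi0 : (0 : ℝ) ≤ i := by positivity
    push_cast at *
    constructor <;> linarith
  have htel := Finset.sum_range_sub (fun i => logRatio k m α (j₀ + i)) N
  simp only [add_zero] at htel
  rw [← htel]
  constructor
  · calc _ ≤ ∑ i ∈ Finset.range N, (3 * |α| ^ 3 + 4 * U / k ^ 2) := by
          refine Finset.sum_le_sum fun i hi => ?_
          have hi := Finset.mem_range.1 hi
          refine (logRatio_succ_sub_bounds hk hmk hkm (j := j₀ + i) (by omega) (by omega) hα
            rfl).1.trans ?_
          have := (hxU i hi).2
          gcongr
      _ = N * (3 * |α| ^ 3 + 4 * U / k ^ 2) := by simp; ring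
      _ ≤ _ := by gcongr
  · intro h4
    calc _ ≤ ∑ i ∈ Finset.range N, |logRatio k m α (j₀ + (i + 1)) - logRatio k m α (j₀ + i)| :=
          Finset.abs_sum_le_sum_abs _ _
      _ ≤ ∑ i ∈ Finset.range N, (3 * |α| ^ 3 + 4 * U / k ^ 2 + 24 * U ^ 3 / k ^ 3) := by
          refine Finset.sum_le_sum fun i hi => ?_
          have hi := Finset.mem_range.1 hi
          have h1 := (hxU i hi).1
          have h2 := (hxU i hi).2
          refine ((logRatio_succ_sub_bounds hk hmk hkm (j := j₀ + i) (by omega) (by omega) hα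
            rfl).2 (by linarith)).trans ?_
          gcongr
      _ = N * (3 * |α| ^ 3 + 4 * U / k ^ 2 + 24 * U ^ 3 / k ^ 3) := by simp; ring
      _ ≤ _ := by gcongr

lemma abs_exp_sub_one_le_mul_exp {θ B : ℝ} (hB : 0 ≤ B) (h : θ ≤ B) :
    |Real.exp θ - 1| ≤ Real.exp B * |θ| := by
  have hB1 : 1 ≤ Real.exp B := Real.one_le_exp hB
  rcases le_total 0 θ with h0 | h0
  · rw [abs_of_nonneg (by linarith [Real.one_le_exp h0]), abs_of_nonneg h0]
    have h1 := Real.add_one_le_exp (-θ)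
    have h2 : Real.exp θ * Real.exp (-θ) = 1 := by rw [← Real.exp_add]; simp
    have h3 : Real.exp θ ≤ Real.exp B := Real.exp_le_exp.2 h
    have h4 := mul_le_mul_of_nonneg_left h1 (Real.exp_pos θ).le
    have h5 := mul_le_mul_of_nonneg_right h3 h0
    linarith
  · rw [abs_of_nonpos (by linarith [Real.exp_le_one_iff.2 h0]), abs_of_nonpos h0]
    have h1 := Real.add_one_le_exp θ
    have h2 : 0 ≤ -θ := by linarith
    nlinarith [mul_le_mul_of_nonneg_right hB1 h2]

set_option maxHeartbeats 1000000 in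
/-- One-sided local limit estimate, up to a normalising constant. -/
lemma exists_abs_binomPMF_sub_le_right (A : ℝ) (hA : 0 ≤ A) :
    ∃ C : ℝ, 256 ≤ C ∧ ∀ k m j₀ j : ℕ, 0 < k → m ≤ k → k ≤ m + 1 → m ≤ 2 * j₀ + 1 → j₀ ≤ j →
      j ≤ m → ∀ α : ℝ, |α| ≤ 1 / 2 → |α| ≤ A / Real.sqrt k → ∀ K : ℝ,
      K = binomPMF m (1 / 2 + α / 2) j₀ / gaussDensity (m / 2 + α * k / 2) (k / 4) j₀ →
      |binomPMF m (1 / 2 + α / 2) j - K * gaussDensity (m / 2 + α * k / 2) (k / 4) j| ≤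
        K * gaussDensity (m / 2 + α * k / 2) (k / 4) j *
          (C / k * (1 + (|(j : ℝ) - m / 2| / Real.sqrt k) ^ 4)) := by
  set B := 3 * A ^ 3 + 2 with hB
  have hB0 : 0 ≤ B := by positivity
  set C1 := 2 * (3 * A ^ 3 + 28) with hC1
  have hC10 : 0 ≤ C1 := by positivity
  have hB1 : 1 ≤ Real.exp B := Real.one_le_exp hB0
  refine ⟨Real.exp B * (C1 + 256), by nlinarith, ?_⟩
  intro k m j₀ j hk hmk hkm h₀ hj₀ hj α hα hαA K hK
  have hk1 : (1 : ℝ) ≤ k := by exact_mod_cast hk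
  have hk' : (0 : ℝ) < k := by linarith
  have hmk' : (m : ℝ) ≤ k := by exact_mod_cast hmk
  have hkm' : (k : ℝ) ≤ m + 1 := by exact_mod_cast hkm
  set s := Real.sqrt k with hs
  have hs1 : 1 ≤ s := by rw [hs]; exact Real.one_le_sqrt.2 hk1
  have hs0 : 0 < s := by linarith
  have hks : (k : ℝ) = s ^ 2 := (Real.sq_sqrt hk'.le).symm
  set U := |(j : ℝ) - m / 2| with hU
  have hU0 : 0 ≤ U := abs_nonneg _
  set Y := U / s with hY
  have hY0 : 0 ≤ Y := by positivity
  have hUY : U = Y * s := by rw [hY]; field_simp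
  have hα3 : |α| ^ 3 ≤ A ^ 3 / s ^ 3 := by
    rw [← div_pow]; gcongr
  set g := gaussDensity (m / 2 + α * k / 2) (k / 4) with hg
  have hgpos : ∀ x, 0 < g x := gaussDensity_pos (by positivity) _
  have hb0 := binomPMF_pos (m := m) (j := j₀) (hj₀.trans hj) hα
  have hb := binomPMF_pos (m := m) (j := j) hj hα
  have hK0 : 0 < K := by rw [hK]; have := hgpos j₀; positivity
  obtain ⟨b1, b2⟩ := logRatio_sub_bounds hk hmk hkm h₀ hj₀ hj hα hU
  set θ := logRatio k m α j - logRatio k m α j₀ with hθ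
  have hexp : binomPMF m (1 / 2 + α / 2) j = K * g j * Real.exp θ := by
    rw [hθ]
    unfold logRatio
    rw [← Real.log_div hb.ne' (hgpos j).ne', ← Real.log_div hb0.ne' (hgpos j₀).ne', ← hK,
      Real.exp_sub, Real.exp_log hK0, Real.exp_log (by have := hgpos j; positivity)]
    have := (hgpos j).ne'
    field_simp
  have hθB : θ ≤ B := by
    refine b1.trans ?_
    have hUm : U ≤ k / 2 := by
      have : (j : ℝ) ≤ m := by exact_mod_cast hj
      have : (0 : ℝ) ≤ j := by positivity
      rw [hU, abs_le]; constructor <;> linarith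
    have e1 : 2 * U * (3 * |α| ^ 3) ≤ 3 * A ^ 3 := by
      calc 2 * U * (3 * |α| ^ 3) ≤ 2 * (k / 2) * (3 * (A ^ 3 / s ^ 3)) := by gcongr
        _ = 3 * A ^ 3 / s := by rw [hks]; field_simp
        _ ≤ 3 * A ^ 3 := div_le_self (by positivity) hs1
    have e2 : 2 * U * (4 * U / (k : ℝ) ^ 2) ≤ 2 := by
      calc 2 * U * (4 * U / (k : ℝ) ^ 2) ≤ 2 * (k / 2) * (4 * (k / 2) / (k : ℝ) ^ 2) := by gcongr
        _ = 2 := by field_simp; norm_num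
    rw [mul_add]
    linarith
  have hgoal : |Real.exp θ - 1| ≤ Real.exp B * (C1 + 256) / k * (1 + Y ^ 4) := by
    by_cases hc : 4 * U ≤ m + 1
    · have hY1 : Y ≤ 1 + Y ^ 4 := by nlinarith [sq_nonneg (Y ^ 2 - 1), sq_nonneg (Y - 1)]
      have hY2 : Y ^ 2 ≤ 1 + Y ^ 4 := by nlinarith [sq_nonneg (Y ^ 2 - 1)]
      have e : |θ| ≤ C1 / k * (1 + Y ^ 4) := by
        calc |θ| ≤ 2 * U * (3 * |α| ^ 3 + 4 * U / k ^ 2 + 24 * U ^ 3 / k ^ 3) := b2 hc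
          _ ≤ 2 * U * (3 * (A ^ 3 / s ^ 3) + 4 * U / k ^ 2 + 24 * U ^ 3 / k ^ 3) := by gcongr
          _ = 2 * (3 * A ^ 3 * Y + 4 * Y ^ 2 + 24 * Y ^ 4) / k := by
              rw [hUY, hks]; field_simp
          _ ≤ 2 * (3 * A ^ 3 * (1 + Y ^ 4) + 4 * (1 + Y ^ 4) + 24 * (1 + Y ^ 4)) / k := by
              gcongr
              linarith
          _ = C1 / k * (1 + Y ^ 4) := by rw [hC1]; ring
      calc |Real.exp θ - 1| ≤ Real.exp B * |θ| := abs_exp_sub_one_le_mul_exp hB0 hθB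
        _ ≤ Real.exp B * (C1 / k * (1 + Y ^ 4)) := by gcongr
        _ = Real.exp B * C1 / k * (1 + Y ^ 4) := by ring
        _ ≤ _ := by gcongr; linarith
    · have hU4 : (k : ℝ) ≤ 4 * U := by linarith
      have hYs : s ≤ 4 * Y := by
        rw [hUY, hks] at hU4
        nlinarith
      have hY4 : (k : ℝ) ≤ 256 * Y ^ 4 := by
        calc (k : ℝ) ≤ (k : ℝ) ^ 2 := by nlinarith
          _ = s ^ 4 := by rw [hks]; ring
          _ ≤ (4 * Y) ^ 4 := by gcongr
          _ = _ := by ring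
      have hE : |Real.exp θ - 1| ≤ Real.exp B := by
        have h1 := Real.exp_pos θ
        have h2 : Real.exp θ ≤ Real.exp B := Real.exp_le_exp.2 hθB
        rw [abs_le]; constructor <;> linarith
      refine hE.trans ?_
      rw [div_mul_eq_mul_div, le_div_iff₀ hk', mul_assoc]
      refine mul_le_mul_of_nonneg_left ?_ (Real.exp_pos B).le
      have : 0 ≤ Y ^ 4 := by positivity
      nlinarith
  rw [hexp, show K * g j * Real.exp θ - K * g j = K * g j * (Real.exp θ - 1) by ring, abs_mul,
    abs_of_pos (mul_pos hK0 (hgpos j))]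
  exact mul_le_mul_of_nonneg_left hgoal (mul_pos hK0 (hgpos j)).le

lemma binomPMF_reflect {m j : ℕ} (hj : j ≤ m) (α : ℝ) :
    binomPMF m (1 / 2 + -α / 2) (m - j) = binomPMF m (1 / 2 + α / 2) j := by
  unfold binomPMF
  rw [Nat.choose_symm hj, Nat.sub_sub_self hj]
  ring

lemma gaussDensity_reflect {m j : ℕ} (hj : j ≤ m) (α κ v : ℝ) :
    gaussDensity (m / 2 + -α * κ / 2) v (m - j : ℕ) = gaussDensity (m / 2 + α * κ / 2) v j := by
  unfold gaussDensity
  rw [Nat.cast_sub hj]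
  ring_nf

/-- The binomial mass function extended by zero to the integers. -/
noncomputable def binomInt (m : ℕ) (p : ℝ) (j : ℤ) : ℝ :=
  if 0 ≤ j ∧ j ≤ m then binomPMF m p j.toNat else 0

set_option maxHeartbeats 1000000 in
/-- Local limit estimate on all of `ℤ`, up to a normalising constant. -/
lemma exists_abs_binomInt_sub_le (A : ℝ) (hA : 0 ≤ A) :
    ∃ C : ℝ, 0 < C ∧ ∀ k m : ℕ, 0 < k → m ≤ k → k ≤ m + 1 →
      ∀ α : ℝ, |α| ≤ 1 / 2 → |α| ≤ A / Real.sqrt k → ∃ K : ℝ, 0 < K ∧ ∀ j : ℤ,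
      |binomInt m (1 / 2 + α / 2) j - K * gaussDensity (m / 2 + α * k / 2) (k / 4) j| ≤
        K * (C / k * gaussDensity (m / 2 + α * k / 2) (2 * (k / 4)) j) := by
  obtain ⟨C, hC, H⟩ := exists_abs_binomPMF_sub_le_right A hA
  refine ⟨C * (2 * (17 + A ^ 4 / 2)), by positivity, ?_⟩
  intro k m hk hmk hkm α hα hαA
  have hk1 : (1 : ℝ) ≤ k := by exact_mod_cast hk
  have hk' : (0 : ℝ) < k := by linarith
  have hmk' : (m : ℝ) ≤ k := by exact_mod_cast hmk
  have hkm' : (k : ℝ) ≤ m + 1 := by exact_mod_cast hkm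
  set s := Real.sqrt k with hs
  have hs1 : 1 ≤ s := by rw [hs]; exact Real.one_le_sqrt.2 hk1
  have hs0 : 0 < s := by linarith
  have hks : (k : ℝ) = s ^ 2 := (Real.sq_sqrt hk'.le).symm
  set μ := (m : ℝ) / 2 + α * k / 2 with hμ
  have hv : 0 < (k : ℝ) / 4 := by positivity
  have hgpos : ∀ x, 0 < gaussDensity μ (k / 4) x := gaussDensity_pos hv _
  have hj₀ : m / 2 ≤ m := Nat.div_le_self _ _
  have hb0 := binomPMF_pos (m := m) (j := m / 2) hj₀ hα
  set K := binomPMF m (1 / 2 + α / 2) (m / 2) / gaussDensity μ (k / 4) (m / 2 : ℕ) with hK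
  have hK0 : 0 < K := by have := hgpos (m / 2 : ℕ); positivity
  refine ⟨K, hK0, fun j => ?_⟩
  have key : |binomInt m (1 / 2 + α / 2) j - K * gaussDensity μ (k / 4) j| ≤
      K * gaussDensity μ (k / 4) j * (C / k * (1 + (|(j : ℝ) - m / 2| / s) ^ 4)) := by
    unfold binomInt
    split_ifs with h
    · obtain ⟨i, rfl⟩ := Int.eq_ofNat_of_zero_le h.1
      have hi : i ≤ m := by omega
      simp only [Int.toNat_natCast, Int.cast_natCast]
      rcases le_total (m / 2) i with hc | hc
      · exact H k m (m / 2) i hk hmk hkm (by omega) hc hi α hα hαA K rfl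
      · have := H k m (m - m / 2) (m - i) hk hmk hkm (by omega) (by omega) (by omega) (-α)
          (by rwa [abs_neg]) (by rwa [abs_neg]) K (by
            rw [binomPMF_reflect hj₀, gaussDensity_reflect hj₀])
        rw [binomPMF_reflect hi, gaussDensity_reflect hi] at this
        have e : |((m - i : ℕ) : ℝ) - m / 2| = |(i : ℝ) - m / 2| := by
          rw [Nat.cast_sub hi, ← abs_neg]; ring_nf
        rwa [e] at this
    · rw [zero_sub, abs_neg, abs_of_pos (mul_pos hK0 (hgpos j))]
      refine le_mul_of_one_le_right (mul_pos hK0 (hgpos j)).le ?_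
      have hU : (k : ℝ) ≤ 4 * |(j : ℝ) - m / 2| := by
        have hm0 : (0 : ℝ) ≤ m := by positivity
        rcases lt_or_ge j 0 with hj | hj
        · have : (j : ℝ) + 1 ≤ 0 := by exact_mod_cast hj
          have := neg_le_abs ((j : ℝ) - m / 2)
          linarith
        · have hjm : (m : ℤ) + 1 ≤ j := by omega
          have : (m : ℝ) + 1 ≤ j := by exact_mod_cast hjm
          have := le_abs_self ((j : ℝ) - m / 2)
          linarith
      set Y := |(j : ℝ) - m / 2| / s with hY
      have hYs : s ≤ 4 * Y := by
        rw [hY, ← mul_div_assoc, le_div_iff₀ hs0]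
        nlinarith
      have hY4 : (k : ℝ) ≤ 256 * Y ^ 4 := by
        calc (k : ℝ) ≤ (k : ℝ) ^ 2 := by nlinarith
          _ = s ^ 4 := by rw [hks]; ring
          _ ≤ (4 * Y) ^ 4 := by gcongr
          _ = _ := by ring
      rw [div_mul_eq_mul_div, le_div_iff₀ hk']
      have : 0 ≤ Y ^ 4 := by positivity
      nlinarith
  refine key.trans ?_
  set w := ((j : ℝ) - μ) ^ 2 / (k / 4) with hw
  have hw0 : 0 ≤ w := by positivity
  set Y := |(j : ℝ) - m / 2| / s with hY
  have hY4 : Y ^ 4 ≤ (w ^ 2 + A ^ 4) / 2 := by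
    set z := |(j : ℝ) - μ| / s with hz
    have hz0 : 0 ≤ z := by positivity
    have hwz : w = 4 * z ^ 2 := by
      rw [hw, hz, div_pow, sq_abs, hks]; field_simp
    have hYz : Y ≤ z + A / 2 := by
      rw [hY, hz, div_add' _ _ _ hs0.ne']
      gcongr
      have e1 : (j : ℝ) - m / 2 = (j - μ) + α * k / 2 := by rw [hμ]; ring
      have e2 : |α * k / 2| ≤ A / 2 * s := by
        rw [abs_div, abs_mul, abs_of_pos hk', abs_of_pos (by norm_num : (0 : ℝ) < 2)]
        calc |α| * k / 2 ≤ A / s * k / 2 := by gcongr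
          _ = A / 2 * s := by rw [hks]; field_simp
      rw [e1]
      exact (abs_add_le _ _).trans (by gcongr)
    have hY0 : 0 ≤ Y := by positivity
    calc Y ^ 4 ≤ (z + A / 2) ^ 4 := by gcongr
      _ = ((z + A / 2) ^ 2) ^ 2 := by ring
      _ ≤ (2 * (z ^ 2 + (A / 2) ^ 2)) ^ 2 := by
          gcongr; nlinarith [sq_nonneg (z - A / 2)]
      _ = 4 * (z ^ 2 + (A / 2) ^ 2) ^ 2 := by ring
      _ ≤ 4 * (2 * ((z ^ 2) ^ 2 + ((A / 2) ^ 2) ^ 2)) := by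
          gcongr; nlinarith [sq_nonneg (z ^ 2 - (A / 2) ^ 2)]
      _ = _ := by rw [hwz]; ring
  have hexp : 1 + Y ^ 4 ≤ (17 + A ^ 4 / 2) * Real.exp (w / 4) := by
    have h1 := Real.quadratic_le_exp_of_nonneg (x := w / 4) (by positivity)
    have h2 : 1 ≤ Real.exp (w / 4) := Real.one_le_exp (by positivity)
    have h3 : 0 ≤ A ^ 4 / 2 := by positivity
    nlinarith
  have h5 := mul_gaussDensity_le_double hv μ j (by positivity) hexp
  calc _ = K * (C / k * ((1 + Y ^ 4) * gaussDensity μ (k / 4) j)) := by ring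
    _ ≤ K * (C / k * (2 * (17 + A ^ 4 / 2) * gaussDensity μ (2 * (k / 4)) j)) := by gcongr
    _ = _ := by ring

lemma tsum_binomInt_mul (m : ℕ) (p : ℝ) (F : ℤ → ℝ) :
    ∑' j : ℤ, binomInt m p j * F j =
      ∑ j ∈ Finset.range (m + 1), binomPMF m p j * F j := by
  rw [tsum_eq_sum (s := (Finset.range (m + 1)).map Nat.castEmbedding)]
  · rw [Finset.sum_map]
    refine Finset.sum_congr rfl fun j hj => ?_
    have : j ≤ m := by simpa [Nat.lt_succ_iff] using hj
    simp [binomInt, this]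
  · intro j hj
    unfold binomInt
    rw [if_neg, zero_mul]
    rintro ⟨h0, h1⟩
    refine hj ?_
    simp only [Finset.mem_map, Finset.mem_range, Nat.castEmbedding_apply]
    exact ⟨j.toNat, by omega, by simp [h0]⟩

lemma summable_binomInt (m : ℕ) (p : ℝ) : Summable (binomInt m p) := by
  refine summable_of_ne_finset_zero (s := (Finset.range (m + 1)).map Nat.castEmbedding) ?_
  intro j hj
  unfold binomInt
  rw [if_neg]
  rintro ⟨h0, h1⟩
  refine hj ?_
  simp only [Finset.mem_map, Finset.mem_range, Nat.castEmbedding_apply]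
  exact ⟨j.toNat, by omega, by simp [h0]⟩

lemma sum_binomPMF (m : ℕ) (p : ℝ) : ∑ j ∈ Finset.range (m + 1), binomPMF m p j = 1 := by
  have h := add_pow p (1 - p) m
  rw [add_sub_cancel, one_pow] at h
  rw [h]
  refine Finset.sum_congr rfl fun j _ => ?_
  unfold binomPMF
  ring

lemma tsum_binomInt (m : ℕ) (p : ℝ) : ∑' j : ℤ, binomInt m p j = 1 := by
  simpa [sum_binomPMF] using tsum_binomInt_mul m p (fun _ => 1)

lemma binomInt_nonneg (m : ℕ) {α : ℝ} (hα : |α| ≤ 1 / 2) (j : ℤ) :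
    0 ≤ binomInt m (1 / 2 + α / 2) j := by
  unfold binomInt
  split_ifs with h
  · exact (binomPMF_pos (by omega) hα).le
  · exact le_rfl

/-- `ℓ¹` distance between a binomial mass function and the matching sampled Gaussian density. -/
lemma exists_tsum_abs_binomInt_sub_le (A : ℝ) (hA : 0 ≤ A) :
    ∃ C > (0 : ℝ), ∃ k₀ : ℝ, 32 ≤ k₀ ∧ ∀ k m : ℕ, k₀ ≤ k → m ≤ k → k ≤ m + 1 →
      ∀ α : ℝ, |α| ≤ A / Real.sqrt k → |α| ≤ 1 / 2 ∧
      ∑' j : ℤ, |binomInt m (1 / 2 + α / 2) j - gaussDensity (m / 2 + α * k / 2) (k / 4) j| ≤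
        C / k := by
  obtain ⟨D, hD, H⟩ := exists_abs_binomInt_sub_le A hA
  refine ⟨4 * D + 2 * (4 * D + 128), by positivity, 128 + 4 * D + 4 * A ^ 2,
    by nlinarith [sq_nonneg A], ?_⟩
  intro k m hk₀ hmk hkm α hαA
  have hA2 := sq_nonneg A
  have hk' : (0 : ℝ) < k := by linarith
  have hk : 0 < k := by exact_mod_cast hk'
  have hα : |α| ≤ 1 / 2 := by
    refine hαA.trans ?_
    rw [div_le_iff₀ (Real.sqrt_pos.2 hk')]
    have : 2 * A ≤ Real.sqrt k := Real.le_sqrt_of_sq_le (by nlinarith)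
    linarith
  refine ⟨hα, ?_⟩
  obtain ⟨K, hK, h⟩ := H k m hk hmk hkm α hα hαA
  set μ := (m : ℝ) / 2 + α * k / 2
  set b := binomInt m (1 / 2 + α / 2) with hb
  have hv : 0 < (k : ℝ) / 4 := by positivity
  have sb : Summable b := summable_binomInt _ _
  have sg : Summable fun j : ℤ => gaussDensity μ (k / 4) j := summable_gaussDensity_int hv μ
  have sg2 : Summable fun j : ℤ => gaussDensity μ (2 * (k / 4)) j :=
    summable_gaussDensity_int (by positivity) μ
  have hS1 := abs_tsum_gaussDensity_int_sub_one_le hv μ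
  have hS2 := tsum_gaussDensity_int_le (v := 2 * ((k : ℝ) / 4)) (by linarith) μ
  have hS1' := tsum_gaussDensity_int_le (v := (k : ℝ) / 4) (by linarith) μ
  set S := ∑' j : ℤ, gaussDensity μ (k / 4) j with hS
  have sd : Summable fun j => b j - K * gaussDensity μ (k / 4) j := sb.sub (sg.mul_left K)
  have h1 : ∑' j : ℤ, |b j - K * gaussDensity μ (k / 4) j| ≤ K * (D / k * 2) := by
    refine (sd.abs.tsum_le_tsum h ((sg2.mul_left _).mul_left _)).trans ?_
    rw [tsum_mul_left, tsum_mul_left]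
    gcongr
  have h2 : |1 - K * S| ≤ K * (D / k * 2) := by
    refine le_trans ?_ h1
    rw [← tsum_binomInt m (1 / 2 + α / 2), hS, ← tsum_mul_left, ← sb.tsum_sub (sg.mul_left K)]
    exact norm_tsum_le_tsum_norm sd.norm
  have e1 : (16 : ℝ) / (k / 4) = 64 * (1 / k) := by field_simp; norm_num
  rw [e1] at hS1
  set r := 1 / (k : ℝ) with hr
  have hr0 : 0 < r := by positivity
  have hDk : D / k = D * r := by rw [hr]; ring
  have hrs : (128 + 4 * D) * r ≤ 1 := by
    rw [hr, mul_one_div, div_le_one hk']; linarith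
  rw [hDk] at h1 h2
  have hK2 : K ≤ 2 := by
    have a1 := (abs_le.1 h2).1
    have a2 := (abs_le.1 hS1).1
    have a3 := mul_le_mul_of_nonneg_left a2 hK.le
    have a4 := mul_le_mul_of_nonneg_left hrs hK.le
    linarith
  have hK1 : |K - 1| ≤ (4 * D + 128) * r := by
    have a1 : K * |S - 1| ≤ 2 * (64 * r) := by gcongr
    have a2 : K * (D * r * 2) ≤ 2 * (D * r * 2) := by gcongr
    have a3 : |K - 1| ≤ |1 - K * S| + K * |S - 1| := by
      calc |K - 1| = |-(1 - K * S) - K * (S - 1)| := by congr 1; ring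
        _ ≤ |-(1 - K * S)| + |K * (S - 1)| := abs_sub _ _
        _ = _ := by rw [abs_neg, abs_mul, abs_of_pos hK]
    linarith
  have h3 : ∀ j : ℤ, |b j - gaussDensity μ (k / 4) j| ≤
      |b j - K * gaussDensity μ (k / 4) j| + |K - 1| * gaussDensity μ (k / 4) j := by
    intro j
    rw [← abs_of_pos (gaussDensity_pos hv μ j), ← abs_mul, abs_of_pos (gaussDensity_pos hv μ j)]
    refine le_trans (le_of_eq ?_) (abs_add_le _ _)
    congr 1
    ring
  refine ((sb.sub sg).abs.tsum_le_tsum h3 (sd.abs.add (sg.mul_left _))).trans ?_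
  rw [sd.abs.tsum_add (sg.mul_left _), tsum_mul_left]
  have a2 : K * (D * r * 2) ≤ 2 * (D * r * 2) := by gcongr
  have hS0 : 0 ≤ S := tsum_nonneg fun j => (gaussDensity_pos hv μ j).le
  have a4 : |K - 1| * S ≤ (4 * D + 128) * r * 2 := by gcongr
  have e2 : (4 * D + 2 * (4 * D + 128)) / k = (4 * D + 2 * (4 * D + 128)) * r := by rw [hr]; ring
  linarith

lemma abs_tsum_prod_sub_le {b b' g g' : ℤ → ℝ} (sb : Summable b) (sb' : Summable b')
    (sg : Summable g) (sg' : Summable g') {B : ℝ} {R : ℤ × ℤ → ℝ} (hR : ∀ z, |R z| ≤ B) :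
    |∑' z : ℤ × ℤ, b z.1 * b' z.2 * R z - ∑' z : ℤ × ℤ, g z.1 * g' z.2 * R z| ≤
      B * ((∑' j, |b j - g j|) * (∑' j, |b' j|) + (∑' j, |g j|) * ∑' j, |b' j - g' j|) := by
  have sd := sb.sub sg
  have sd' := sb'.sub sg'
  have hR' : ∀ {f : ℤ × ℤ → ℝ}, Summable f → Summable fun z => f z * R z := by
    intro f hf
    refine Summable.of_norm_bounded (hf.abs.mul_right B) fun z => ?_
    rw [norm_mul]
    exact mul_le_mul_of_nonneg_left (hR z) (norm_nonneg _)
  have p1 := summable_mul_of_summable_norm sb.norm sb'.norm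
  have p2 := summable_mul_of_summable_norm sg.norm sg'.norm
  have q1 := summable_mul_of_summable_norm sd.abs.norm sb'.abs.norm
  have q2 := summable_mul_of_summable_norm sg.abs.norm sd'.abs.norm
  rw [← (hR' p1).tsum_sub (hR' p2), ← Real.norm_eq_abs,
    tsum_mul_tsum_of_summable_norm sd.abs.norm sb'.abs.norm,
    tsum_mul_tsum_of_summable_norm sg.abs.norm sd'.abs.norm, ← q1.tsum_add q2, ← tsum_mul_left]
  refine tsum_of_norm_bounded ((q1.add q2).mul_left B).hasSum fun z => ?_
  have e : b z.1 * b' z.2 * R z - g z.1 * g' z.2 * R z =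
      ((b z.1 - g z.1) * b' z.2 + g z.1 * (b' z.2 - g' z.2)) * R z := by ring
  rw [e, norm_mul, mul_comm B]
  refine mul_le_mul ((norm_add_le _ _).trans (le_of_eq ?_)) (hR z) (norm_nonneg _) (by positivity)
  simp

lemma gaussDensity_mul_gaussDensity_sub {v : ℝ} (hv : 0 < v) (μ ν x e : ℝ) :
    gaussDensity μ v x * gaussDensity ν v (x - e) =
      gaussDensity (μ - ν) (2 * v) e * gaussDensity ((μ + ν + e) / 2) (v / 2) x := by
  unfold gaussDensity
  have h2 : Real.sqrt (2 * Real.pi * v) * Real.sqrt (2 * Real.pi * v) =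
      Real.sqrt (2 * Real.pi * (2 * v)) * Real.sqrt (2 * Real.pi * (v / 2)) := by
    have := Real.pi_pos
    rw [← Real.sqrt_mul (by positivity), ← Real.sqrt_mul (by positivity)]
    congr 1; ring
  rw [mul_mul_mul_comm (Real.sqrt (2 * Real.pi * v))⁻¹,
    mul_mul_mul_comm (Real.sqrt (2 * Real.pi * (2 * v)))⁻¹, ← Real.exp_add, ← Real.exp_add, ← mul_inv, ← mul_inv, h2]
  congr 2
  field_simp
  ring

/-- Re-indexing pairs of integers by difference and first coordinate. -/
def subFstEquiv : ℤ × ℤ ≃ ℤ × ℤ where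
  toFun z := (z.2, z.2 - z.1)
  invFun z := (z.1 - z.2, z.1)
  left_inv z := by simp
  right_inv z := by simp

lemma abs_tsum_gaussDensity_sub_le {v : ℝ} (hv : 16 ≤ v) (μ ν : ℝ) {B : ℝ} {Q : ℤ → ℝ}
    (hQ : ∀ e, |Q e| ≤ B) :
    |∑' z : ℤ × ℤ, gaussDensity μ v z.1 * gaussDensity ν v z.2 * Q (z.1 - z.2) -
      ∑' e : ℤ, gaussDensity (μ - ν) (2 * v) e * Q e| ≤ 64 * B / v := by
  have hv0 : 0 < v := by linarith
  have hB : 0 ≤ B := (abs_nonneg _).trans (hQ 0)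
  have sμ := summable_gaussDensity_int hv0 μ
  have sν := summable_gaussDensity_int hv0 ν
  have sD := summable_gaussDensity_int (v := 2 * v) (by positivity) (μ - ν)
  have s := summable_mul_of_summable_norm sμ.norm sν.norm
  have sQ : Summable fun z : ℤ × ℤ =>
      gaussDensity μ v z.1 * gaussDensity ν v z.2 * Q (z.1 - z.2) := by
    refine Summable.of_norm_bounded (s.abs.mul_right B) fun z => ?_
    rw [norm_mul]
    exact mul_le_mul_of_nonneg_left (hQ _) (norm_nonneg _)
  have sDQ : Summable fun e : ℤ => gaussDensity (μ - ν) (2 * v) e * Q e := by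
    refine Summable.of_norm_bounded (sD.abs.mul_right B) fun z => ?_
    rw [norm_mul]
    exact mul_le_mul_of_nonneg_left (hQ _) (norm_nonneg _)
  set T : ℤ → ℝ := fun e => ∑' x : ℤ, gaussDensity ((μ + ν + e) / 2) (v / 2) x with hT
  have hT1 : ∀ e, |T e - 1| ≤ 32 / v := fun e => by
    have := abs_tsum_gaussDensity_int_sub_one_le (v := v / 2) (by positivity) ((μ + ν + e) / 2)
    rwa [show (16 : ℝ) / (v / 2) = 32 / v by field_simp; norm_num] at this
  have hbd : ∀ e : ℤ, ‖gaussDensity (μ - ν) (2 * v) e * Q e * (T e - 1)‖ ≤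
      gaussDensity (μ - ν) (2 * v) e * (B * (32 / v)) := fun e => by
    rw [norm_mul, norm_mul, Real.norm_of_nonneg (gaussDensity_pos (by positivity) _ _).le, mul_assoc]
    refine mul_le_mul_of_nonneg_left ?_ (gaussDensity_pos (by positivity) _ _).le
    exact mul_le_mul (hQ e) (hT1 e) (norm_nonneg _) hB
  have sDT : Summable fun e : ℤ => gaussDensity (μ - ν) (2 * v) e * Q e * (T e - 1) :=
    Summable.of_norm_bounded (sD.mul_right _) hbd
  have e1 : ∑' z : ℤ × ℤ, gaussDensity μ v z.1 * gaussDensity ν v z.2 * Q (z.1 - z.2) =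
      ∑' e : ℤ, gaussDensity (μ - ν) (2 * v) e * Q e * T e := by
    refine (subFstEquiv.tsum_eq _).symm.trans
      ((Summable.tsum_prod (subFstEquiv.summable_iff.2 sQ)).trans ?_)
    refine tsum_congr fun e => ?_
    rw [hT, ← tsum_mul_left]
    refine tsum_congr fun x => ?_
    have := gaussDensity_mul_gaussDensity_sub hv0 μ ν x e
    simp only [Function.comp_apply, subFstEquiv, Equiv.coe_fn_mk, Int.cast_sub, sub_sub_cancel]
    rw [this]
    ring
  have e2 : ∑' e : ℤ, gaussDensity (μ - ν) (2 * v) e * Q e * T e =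
      ∑' e : ℤ, gaussDensity (μ - ν) (2 * v) e * Q e * (T e - 1) +
        ∑' e : ℤ, gaussDensity (μ - ν) (2 * v) e * Q e := by
    rw [← sDT.tsum_add sDQ]
    exact tsum_congr fun e => by ring
  rw [e1, e2, add_sub_cancel_right, ← Real.norm_eq_abs]
  refine (tsum_of_norm_bounded (sD.mul_right _).hasSum hbd).trans ?_
  rw [tsum_mul_right]
  have := tsum_gaussDensity_int_le (v := 2 * v) (by linarith) (μ - ν)
  calc _ ≤ 2 * (B * (32 / v)) := by gcongr
    _ = _ := by ring

/-- Smoothed local limit theorem for the difference of two independent binomial variables. -/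
lemma exists_abs_sum_binomPMF_sub_le (A : ℝ) (hA : 0 ≤ A) :
    ∃ C > (0 : ℝ), ∃ k₀ : ℝ, 1 ≤ k₀ ∧ ∀ k m m' : ℕ, k₀ ≤ k → m ≤ k → k ≤ m + 1 →
      m' ≤ k → k ≤ m' + 1 →
      ∀ α α' : ℝ, |α| ≤ A / Real.sqrt k → |α'| ≤ A / Real.sqrt k → |α| ≤ 1 / 2 ∧ |α'| ≤ 1 / 2 ∧
      ∀ (B : ℝ) (Q : ℤ → ℝ), (∀ e, |Q e| ≤ B) →
      |∑ x ∈ Finset.range (m + 1), ∑ y ∈ Finset.range (m' + 1),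
          binomPMF m (1 / 2 + α / 2) x * binomPMF m' (1 / 2 + α' / 2) y * Q (x - y) -
        ∑' e : ℤ, gaussDensity ((m - m') / 2 + (α - α') * k / 2) (k / 2) e * Q e| ≤
        C * B / k := by
  obtain ⟨D, hD, k₀, hk₀, H⟩ := exists_tsum_abs_binomInt_sub_le A hA
  refine ⟨3 * D + 256, by positivity, k₀ + 64, by linarith, ?_⟩
  intro k m m' hk hmk hkm hmk' hkm' α α' hα hα'
  obtain ⟨h1, h2⟩ := H k m (by linarith) hmk hkm α hα
  obtain ⟨h1', h2'⟩ := H k m' (by linarith) hmk' hkm' α' hα'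
  refine ⟨h1, h1', fun B Q hQ => ?_⟩
  have hB : 0 ≤ B := (abs_nonneg _).trans (hQ 0)
  have hk' : (0 : ℝ) < k := by linarith
  have hv : 0 < (k : ℝ) / 4 := by positivity
  set b := binomInt m (1 / 2 + α / 2) with hb
  set b' := binomInt m' (1 / 2 + α' / 2) with hb'
  set μ := (m : ℝ) / 2 + α * k / 2 with hμ
  set ν := (m' : ℝ) / 2 + α' * k / 2 with hν
  have sb : Summable b := summable_binomInt _ _
  have sb' : Summable b' := summable_binomInt _ _
  have sg := summable_gaussDensity_int hv μ
  have sg' := summable_gaussDensity_int hv ν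
  have d1 := abs_tsum_prod_sub_le sb sb' sg sg' (R := fun z => Q (z.1 - z.2)) (fun z => hQ _)
  have d2 := abs_tsum_gaussDensity_sub_le (v := (k : ℝ) / 4) (by linarith) μ ν hQ
  have hb'1 : ∑' j, |b' j| = 1 := by
    rw [← tsum_binomInt m' (1 / 2 + α' / 2)]
    exact tsum_congr fun j => abs_of_nonneg (binomInt_nonneg m' h1' j)
  have hg1 : ∑' j : ℤ, |gaussDensity μ (k / 4) j| ≤ 2 := by
    refine le_of_eq_of_le (tsum_congr fun j => abs_of_nonneg (gaussDensity_pos hv μ j).le) ?_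
    exact tsum_gaussDensity_int_le (by linarith) μ
  have hsum : ∑ x ∈ Finset.range (m + 1), ∑ y ∈ Finset.range (m' + 1),
      binomPMF m (1 / 2 + α / 2) x * binomPMF m' (1 / 2 + α' / 2) y * Q (x - y) =
      ∑' z : ℤ × ℤ, b z.1 * b' z.2 * Q (z.1 - z.2) := by
    have s : Summable fun z : ℤ × ℤ => b z.1 * b' z.2 * Q (z.1 - z.2) := by
      refine Summable.of_norm_bounded
        ((summable_mul_of_summable_norm sb.norm sb'.norm).abs.mul_right B) fun z => ?_
      rw [norm_mul]
      exact mul_le_mul_of_nonneg_left (hQ _) (norm_nonneg _)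
    rw [s.tsum_prod]
    simp_rw [mul_assoc, tsum_mul_left]
    rw [tsum_binomInt_mul m _ fun x => ∑' y, b' y * Q (x - y)]
    refine Finset.sum_congr rfl fun x _ => ?_
    rw [tsum_binomInt_mul m' _ fun y => Q (x - y), Finset.mul_sum]
  have e1 : μ - ν = (m - m') / 2 + (α - α') * k / 2 := by rw [hμ, hν]; ring
  rw [e1, show 2 * ((k : ℝ) / 4) = k / 2 by ring] at d2
  rw [hsum]
  refine (abs_sub_le _ _ _).trans ((add_le_add d1 d2).trans ?_)
  rw [hb'1]
  calc _ ≤ B * (D / k * 1 + 2 * (D / k)) + 64 * B / (k / 4) := by gcongr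
    _ = _ := by field_simp; ring

lemma gaussianReal_map_affine (σ : NNReal) (μ : ℝ) :
    (gaussianReal 0 1).map (fun x => σ * x + μ) = gaussianReal μ (σ ^ 2) := by
  rw [show (fun x : ℝ => σ * x + μ) = (fun x => x + μ) ∘ (fun x => σ * x) from rfl,
    ← Measure.map_map (by fun_prop) (by fun_prop), gaussianReal_map_const_mul,
    gaussianReal_map_add_const]
  congr 1
  · simp
  · ext; simp

lemma gauss2_corner_toReal {σ τ : NNReal} (hσ : 0 < σ) (hτ : 0 < τ) (μ ν c : ℝ) :
    (gauss2 {p : ℝ × ℝ | c + |τ * p.2 + ν| ≤ σ * p.1 + μ}).toReal =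
      ∫ y, gaussDensity ν (τ ^ 2) y * gaussTail μ (σ ^ 2) (c + |y|) := by
  have hS : MeasurableSet {q : ℝ × ℝ | c + |q.2| ≤ q.1} :=
    measurableSet_le (by fun_prop) (by fun_prop)
  have e1 : gauss2 {p : ℝ × ℝ | c + |τ * p.2 + ν| ≤ σ * p.1 + μ} =
      ((gaussianReal μ (σ ^ 2)).prod (gaussianReal ν (τ ^ 2))) {q : ℝ × ℝ | c + |q.2| ≤ q.1} := by
    rw [← gaussianReal_map_affine σ μ, ← gaussianReal_map_affine τ ν,
      Measure.map_prod_map _ _ (by fun_prop) (by fun_prop),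
      Measure.map_apply (by fun_prop) hS]
    rfl
  have hσ2 : σ ^ 2 ≠ 0 := by positivity
  have hτ2 : τ ^ 2 ≠ 0 := by positivity
  have hσ' : (0 : ℝ) < (σ : ℝ) ^ 2 := by positivity
  have e2 : ∀ y : ℝ, gaussianReal μ (σ ^ 2) ((fun x => (x, y)) ⁻¹' {q : ℝ × ℝ | c + |q.2| ≤ q.1}) =
      ENNReal.ofReal (gaussTail μ (σ ^ 2) (c + |y|)) := fun y => by
    rw [show (fun x => (x, y)) ⁻¹' {q : ℝ × ℝ | c + |q.2| ≤ q.1} = Set.Ici (c + |y|) from rfl,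
      gaussianReal_apply_eq_integral _ hσ2, integral_Ici_eq_integral_Ioi]
    rfl
  rw [e1, Measure.prod_apply_symm hS]
  simp_rw [e2]
  rw [← integral_eq_lintegral_of_nonneg_ae
    (Filter.Eventually.of_forall fun y => gaussTail_nonneg hσ' _ _)
    ((continuous_gaussTail hσ' μ).comp (by fun_prop)).aestronglyMeasurable,
    integral_gaussianReal_eq_integral_smul hτ2]
  rfl

/-- Rescaling the corner probability by `√n`. -/
lemma gGauss_eq_integral {n β : ℝ} (hn : 0 < n) (hβ : 0 < β) (hβ' : β < 1) (G a₁ a₂ a₃ a₄ : ℝ) :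
    gGauss (G / Real.sqrt n) β a₁ a₂ a₃ a₄ =
      ∫ y, gaussDensity ((a₂ - a₄) / Real.sqrt n * ((1 - β) * n) / 2) ((1 - β) * n / 2) y *
        gaussTail (-(1 / 2) + (a₁ - a₃) / Real.sqrt n * (β * n) / 2) (β * n / 2)
          (G - 1 / 2 + |y|) := by
  set s := Real.sqrt n with hs
  have hs0 : 0 < s := Real.sqrt_pos.2 hn
  have hns : n = s ^ 2 := (Real.sq_sqrt hn.le).symm
  have h1β : 0 < 1 - β := by linarith
  obtain ⟨σ, hσ⟩ : ∃ σ : NNReal, (σ : ℝ) = Real.sqrt (β / 2) * s :=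
    ⟨Real.toNNReal _, Real.coe_toNNReal _ (by positivity)⟩
  have hσ0 : 0 < σ := by
    rw [← NNReal.coe_pos, hσ]; positivity
  have hσ2 : (σ : ℝ) ^ 2 = β * n / 2 := by
    rw [hσ, mul_pow, Real.sq_sqrt (by positivity), ← hns]; ring
  obtain ⟨τ, hτ⟩ : ∃ τ : NNReal, (τ : ℝ) = Real.sqrt ((1 - β) / 2) * s :=
    ⟨Real.toNNReal _, Real.coe_toNNReal _ (by positivity)⟩
  have hτ0 : 0 < τ := by
    rw [← NNReal.coe_pos, hτ]; positivity
  have hτ2 : (τ : ℝ) ^ 2 = (1 - β) * n / 2 := by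
    rw [hτ, mul_pow, Real.sq_sqrt (by positivity), ← hns]; ring
  rw [← hσ2, ← hτ2, ← gauss2_corner_toReal hσ0 hτ0]
  unfold gGauss
  congr 2
  ext p
  simp only [Set.mem_ofPred_eq]
  set u := Real.sqrt (β / 2)
  set w := Real.sqrt ((1 - β) / 2)
  rw [hσ, hτ]
  have q1 : G / s + ((a₃ - a₁) * β + (a₄ - a₂) * (1 - β)) / 2 ≤ u * p.1 + w * p.2 ↔
      G - 1 / 2 + -(w * s * p.2 + (a₂ - a₄) / s * ((1 - β) * n) / 2) ≤
        u * s * p.1 + (-(1 / 2) + (a₁ - a₃) / s * (β * n) / 2) := by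
    rw [← mul_le_mul_iff_of_pos_right hs0, ← sub_nonneg, ← sub_nonneg (b := G - 1 / 2 + _)]
    refine iff_of_eq (congrArg _ ?_)
    rw [hns]; field_simp; ring
  have q2 : G / s + ((a₃ - a₁) * β - (a₄ - a₂) * (1 - β)) / 2 ≤ u * p.1 - w * p.2 ↔
      G - 1 / 2 + (w * s * p.2 + (a₂ - a₄) / s * ((1 - β) * n) / 2) ≤
        u * s * p.1 + (-(1 / 2) + (a₁ - a₃) / s * (β * n) / 2) := by
    rw [← mul_le_mul_iff_of_pos_right hs0, ← sub_nonneg, ← sub_nonneg (b := G - 1 / 2 + _)]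
    refine iff_of_eq (congrArg _ ?_)
    rw [hns]; field_simp; ring
  simp only [q1, q2]
  rw [← le_sub_iff_add_le' (b := |_|), abs_le', le_sub_iff_add_le', le_sub_iff_add_le', and_comm]

lemma binomCornerProb_eq_sum {n k : ℕ} (hk : 0 < k) (p₁ p₂ p₃ p₄ : ℝ) (Γ : ℤ) :
    binomCornerProb n k p₁ p₂ p₃ p₄ Γ =
      ∑ x ∈ Finset.range (n - k + 1), ∑ y ∈ Finset.range (n - k + 1),
        binomPMF (n - k) p₂ x * binomPMF (n - k) p₄ y *
          (fun e : ℤ => ∑ x ∈ Finset.range (k - 1 + 1), ∑ y ∈ Finset.range (k + 1),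
            binomPMF (k - 1) p₁ x * binomPMF k p₃ y *
              (if Γ + |e| ≤ (x : ℤ) - y then 1 else 0)) (x - y) := by
  unfold binomCornerProb
  rw [Nat.sub_add_cancel hk, Finset.sum_comm]
  refine Finset.sum_congr rfl fun x₂ _ => ?_
  rw [Finset.sum_comm, Finset.sum_congr rfl fun x₃ _ => Finset.sum_comm, Finset.sum_comm]
  refine Finset.sum_congr rfl fun x₄ _ => ?_
  rw [Finset.mul_sum, Finset.sum_comm]
  refine Finset.sum_congr rfl fun x₁ _ => ?_
  rw [Finset.mul_sum]
  refine Finset.sum_congr rfl fun x₃ _ => ?_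
  have e : (Γ ≤ (x₁ : ℤ) - x₃ + x₂ - x₄ ∧ Γ ≤ (x₁ : ℤ) - x₃ - x₂ + x₄) ↔
      Γ + |(x₂ : ℤ) - x₄| ≤ (x₁ : ℤ) - x₃ := by
    rw [← le_sub_iff_add_le', abs_le]
    omega
  simp only [e]
  split_ifs <;> ring

/-- Fix `C ≥ 1`. There are `C' = C'(C) > 0` and `n₀ = n₀(C)` such that
for all `n ≥ n₀`, `a₁,a₂,a₃,a₄ ∈ [−C,C]`, integers `k = βn` with `min(β,1−β) ≥ 1/C`, and
integers `Γ` with `|Γ| ≤ √n`, writing `γ = Γ/√n`: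
`|P[X₁−X₃+X₂−X₄ ≥ Γ ∧ X₁−X₃−X₂+X₄ ≥ Γ] − g_γ(β,a₁,a₂,a₃,a₄)| ≤ C'/n`. -/
theorem binomial_corner_gaussian_approx (C : ℝ) (hC : 1 ≤ C) :
    ∃ C' : ℝ, 0 < C' ∧ ∃ n₀ : ℕ, ∀ n : ℕ, n₀ ≤ n →
      ∀ a₁ a₂ a₃ a₄ : ℝ,
        a₁ ∈ Set.Icc (-C) C → a₂ ∈ Set.Icc (-C) C →
        a₃ ∈ Set.Icc (-C) C → a₄ ∈ Set.Icc (-C) C →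
      ∀ k : ℕ, ∀ β : ℝ, (k : ℝ) = β * n → 1 / C ≤ min β (1 - β) →
      ∀ Γ : ℤ, |(Γ : ℝ)| ≤ Real.sqrt n →
        |binomCornerProb n k
            (1 / 2 + a₁ / (2 * Real.sqrt n)) (1 / 2 + a₂ / (2 * Real.sqrt n))
            (1 / 2 + a₃ / (2 * Real.sqrt n)) (1 / 2 + a₄ / (2 * Real.sqrt n)) Γ -
          gGauss ((Γ : ℝ) / Real.sqrt n) β a₁ a₂ a₃ a₄| ≤ C' / n := by
  have hC0 : 0 < C := by linarith
  obtain ⟨D, hD, k₀, hk₀, H⟩ := exists_abs_sum_binomPMF_sub_le C hC0.le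
  refine ⟨C * (2 * D + 16) + 96 * C, by positivity, ⌈C * k₀⌉₊, ?_⟩
  intro n hn a₁ a₂ a₃ a₄ ha₁ ha₂ ha₃ ha₄ k β hkβ hβ Γ _
  have hnC : k₀ ≤ n / C := by
    rw [le_div_iff₀ hC0, mul_comm]
    exact (Nat.le_ceil _).trans (by exact_mod_cast hn)
  have hn0 : (0 : ℝ) < n := by
    have : 0 < (n : ℝ) / C := by linarith
    rwa [div_pos_iff_of_pos_right hC0] at this
  obtain ⟨hβ1, hβ2⟩ := le_min_iff.1 hβ
  have hC1 : 0 < 1 / C := by positivity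
  have hkn : (n : ℝ) / C ≤ k := by
    rw [hkβ, div_eq_mul_one_div, mul_comm]; gcongr
  have hkn' : (n : ℝ) / C ≤ n - k := by
    rw [hkβ, div_eq_mul_one_div, mul_comm]
    calc _ ≤ (1 - β) * n := by gcongr
      _ = _ := by ring
  have hk1 : (1 : ℝ) ≤ k := by linarith
  have hk0 : 0 < k := by exact_mod_cast hk1
  have hkle : k ≤ n := by
    have : (k : ℝ) ≤ n := by linarith
    exact_mod_cast this
  set l := n - k with hl
  have hlc : (l : ℝ) = n - k := by rw [hl, Nat.cast_sub hkle]
  have hβl : (1 - β) * n = l := by rw [hlc, hkβ]; ring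
  have hl1 : (1 : ℝ) ≤ l := by linarith
  set s := Real.sqrt n with hs
  have hα : ∀ j : ℕ, (1 : ℝ) ≤ j → (j : ℝ) ≤ n → ∀ a ∈ Set.Icc (-C) C,
      |a / s| ≤ C / Real.sqrt j := by
    intro j hj hjn a ha
    rw [abs_div, abs_of_nonneg (Real.sqrt_nonneg n)]
    have : 0 < Real.sqrt j := Real.sqrt_pos.2 (by linarith)
    have := abs_le.2 ha
    gcongr
  have hkn1 : (k : ℝ) ≤ n := by linarith
  have hln1 : (l : ℝ) ≤ n := by linarith
  obtain ⟨-, -, hin⟩ := H k (k - 1) k (by linarith) (by omega) (by omega) le_rfl (by omega)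
    (a₁ / s) (a₃ / s) (hα k hk1 hkn1 a₁ ha₁) (hα k hk1 hkn1 a₃ ha₃)
  obtain ⟨h2, h4, hout⟩ := H l l l (by linarith) le_rfl (by omega) le_rfl (by omega)
    (a₂ / s) (a₄ / s) (hα l hl1 hln1 a₂ ha₂) (hα l hl1 hln1 a₄ ha₄)
  have ha : ∀ a : ℝ, a / (2 * s) = a / s / 2 := fun a => by rw [mul_comm, div_div]
  rw [ha, ha, ha, ha, binomCornerProb_eq_sum hk0, gGauss_eq_integral hn0 (by linarith) (by linarith),
    ← hkβ, hβl, ← hl, ← hs]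
  have hμ : (((k - 1 : ℕ) : ℝ) - k) / 2 + (a₁ / s - a₃ / s) * k / 2 =
      -(1 / 2) + (a₁ - a₃) / s * k / 2 := by
    rw [Nat.cast_sub (by omega)]; push_cast; ring
  have hν : ((l : ℝ) - l) / 2 + (a₂ / s - a₄ / s) * l / 2 = (a₂ - a₄) / s * l / 2 := by ring
  rw [hμ] at hin
  rw [hν] at hout
  set μ := -(1 / 2) + (a₁ - a₃) / s * k / 2
  set ν := (a₂ - a₄) / s * l / 2
  have hv : 0 < (k : ℝ) / 2 := by positivity
  set T : ℤ → ℝ := fun e => gaussTail μ (k / 2) (Γ - 1 / 2 + |(e : ℝ)|) with hT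
  set P : ℤ → ℝ := fun e => ∑ x ∈ Finset.range (k - 1 + 1), ∑ y ∈ Finset.range (k + 1),
    binomPMF (k - 1) (1 / 2 + a₁ / s / 2) x * binomPMF k (1 / 2 + a₃ / s / 2) y *
      (if Γ + |e| ≤ (x : ℤ) - y then 1 else 0) with hP
  have hPT : ∀ e, |P e - T e| ≤ (D + 16) / k := fun e => by
    have e1 := hin 1 (fun d => if Γ + |e| ≤ d then 1 else 0)
      (fun d => by split_ifs <;> simp)
    have e2 := abs_tsum_indicator_sub_gaussTail_le hv μ (Γ + |e|)
    have e3 : (((Γ + |e| : ℤ) : ℝ) - 1 / 2) = Γ - 1 / 2 + |(e : ℝ)| := by push_cast; ring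
    rw [e3] at e2
    refine (abs_sub_le _ _ _).trans ((add_le_add e1 e2).trans (le_of_eq ?_))
    field_simp; ring
  have hT1 : ∀ e, |T e| ≤ 1 := fun e => by
    rw [abs_of_nonneg (gaussTail_nonneg hv _ _)]
    exact gaussTail_le_one hv _ _
  have s2 := hout 1 T hT1
  have s3 := abs_tsum_mul_gaussTail_abs_sub_integral_le (L := n / C / 2) (v := l / 2) (w := k / 2)
    (by positivity) (by linarith) (by linarith) ν μ (Γ - 1 / 2)
  have s1 : |∑ x ∈ Finset.range (l + 1), ∑ y ∈ Finset.range (l + 1),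
        binomPMF l (1 / 2 + a₂ / s / 2) x * binomPMF l (1 / 2 + a₄ / s / 2) y * P (x - y) -
      ∑ x ∈ Finset.range (l + 1), ∑ y ∈ Finset.range (l + 1),
        binomPMF l (1 / 2 + a₂ / s / 2) x * binomPMF l (1 / 2 + a₄ / s / 2) y * T (x - y)| ≤
      (D + 16) / k := by
    simp_rw [← Finset.sum_sub_distrib, ← mul_sub]
    calc _ ≤ ∑ x ∈ Finset.range (l + 1), ∑ y ∈ Finset.range (l + 1),
        binomPMF l (1 / 2 + a₂ / s / 2) x * binomPMF l (1 / 2 + a₄ / s / 2) y *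
          ((D + 16) / k) := by
          refine (Finset.abs_sum_le_sum_abs _ _).trans (Finset.sum_le_sum fun x hx => ?_)
          refine (Finset.abs_sum_le_sum_abs _ _).trans (Finset.sum_le_sum fun y hy => ?_)
          have hx' := binomPMF_pos (Finset.mem_range_succ_iff.1 hx) h2
          have hy' := binomPMF_pos (Finset.mem_range_succ_iff.1 hy) h4
          rw [abs_mul, abs_of_pos (mul_pos hx' hy')]
          exact mul_le_mul_of_nonneg_left (hPT _) (mul_pos hx' hy').le
      _ = _ := by
          simp_rw [← Finset.sum_mul, ← Finset.mul_sum, sum_binomPMF, mul_one]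
          rw [sum_binomPMF, one_mul]
  have key := (abs_sub_le _ _ _).trans (add_le_add ((abs_sub_le _ _ _).trans (add_le_add s1 s2)) s3)
  refine key.trans ?_
  calc (D + 16) / k + D * 1 / l + 48 / (n / C / 2)
      ≤ (D + 16) / (n / C) + D * 1 / (n / C) + 48 / (n / C / 2) := by
        gcongr
        linarith
    _ = _ := by field_simp; ring
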